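/- arXiv:2112.02633 — 6 statements merged into one kernel-verified Lean document; each statement's English description precedes it below -/
import Mathlib

section
/- There are only countably many hereditary classes of finite posets of width at most two that are well-quasi-ordered by embeddability; that is, the collection of all such classes (each class being a set of isomorphism classes of finite posets of width at most two, closed downward under embeddability) that are wqo is countable. -/
/-- A finite poset, encoded as a partial order on `Fin n` for some `n`. -/
abbrev FinPoset := Σ n : ℕ, PartialOrder (Fin n)

/-- Embeddability of finite posets: an order-embedding of `P` into `Q`. -/
def PEmb (P Q : FinPoset) : Prop :=
  ∃ f : Fin P.1 → Fin Q.1, Function.Injective f ∧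
    ∀ a b : Fin P.1, P.2.le a b ↔ Q.2.le (f a) (f b)

/-- A hereditary class of finite posets. -/
def PHered (C : Set FinPoset) : Prop := ∀ P Q : FinPoset, PEmb P Q → Q ∈ C → P ∈ C

/-- A class of finite posets is well-quasi-ordered by embeddability. -/
def PWqo (C : Set FinPoset) : Prop :=
  ∀ f : ℕ → FinPoset, (∀ i, f i ∈ C) → ∃ i j, i < j ∧ PEmb (f i) (f j)

/-- The relation `le` has width at most two: no three pairwise incomparable elements. -/
def WidthLE2 {α : Type*} (le : α → α → Prop) : Prop :=
  ∀ a b c : α, (¬ le a b ∧ ¬ le b a) → (¬ le a c ∧ ¬ le c a) →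
    (¬ le b c ∧ ¬ le c b) → False

/-- The strict order on `α` in which elements of the same side `s` are compared through `f`,
and elements of different sides are comparable when their values of `f` differ by more than
one. -/
def RLt {α : Type*} (s : α → Bool) (f : α → ℚ) (x y : α) : Prop :=
  (s x = s y ∧ f x < f y) ∨ (s x ≠ s y ∧ f x + 1 < f y)

/-- Incomparability on different sides, with respect to `RLt s f`. -/
def RInc {α : Type*} (s : α → Bool) (f : α → ℚ) (x y : α) : Prop :=
  s x ≠ s y ∧ f x ≤ f y + 1 ∧ f y ≤ f x + 1

theorem exists_chain_coloring {α : Type*} [PartialOrder α] (n : ℕ) :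
    ∀ T : Finset α, T.card = n →
      (∀ a ∈ T, ∀ b ∈ T, ∀ c ∈ T, (¬ a ≤ b ∧ ¬ b ≤ a) → (¬ a ≤ c ∧ ¬ c ≤ a) →
        (¬ b ≤ c ∧ ¬ c ≤ b) → False) →
      ∃ s : α → Bool, ∀ x ∈ T, ∀ y ∈ T, s x = s y → x ≤ y ∨ y ≤ x := by
  classical
  induction n with
  | zero =>
    intro T hT _
    rw [Finset.card_eq_zero] at hT
    subst hT
    exact ⟨fun _ => true, by simp⟩
  | succ n ih =>
    intro T hT hw
    have hne : T.Nonempty := by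
      rw [← Finset.card_pos]; omega
    obtain ⟨z, hz⟩ := T.exists_maximal hne
    have hzmax : ∀ x ∈ T, z ≤ x → x = z := fun x hx h => le_antisymm (hz.2 hx h) h
    obtain ⟨s, hs⟩ := ih (T.erase z) (by rw [Finset.card_erase_of_mem hz.1]; omega)
      (fun a ha b hb c hc => hw a (Finset.mem_of_mem_erase ha) b (Finset.mem_of_mem_erase hb) c
        (Finset.mem_of_mem_erase hc))
    -- the elements of side `i` which have an incomparable partner
    let A : Bool → Finset α := fun i => (T.erase z).filter fun x => s x = i ∧
      ∃ y ∈ T.erase z, s y ≠ i ∧ ¬ x ≤ y ∧ ¬ y ≤ x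
    have hA : ∀ i x, x ∈ A i ↔ (x ∈ T.erase z ∧ s x = i ∧
      ∃ y ∈ T.erase z, s y ≠ i ∧ ¬ x ≤ y ∧ ¬ y ≤ x) := by
      intro i x; simp only [A, Finset.mem_filter]
    by_cases hAne : (A true).Nonempty
    · obtain ⟨x0, hx0⟩ := hAne
      have hBne : (A false).Nonempty := by
        obtain ⟨h1, h2, y, hy, h3, h4, h5⟩ := (hA _ _).1 hx0
        refine ⟨y, (hA _ _).2 ⟨hy, by simpa using h3, x0, h1, by simp [h2], h5, h4⟩⟩
      have hmax : ∀ i, ∃ m ∈ A i, ∀ x ∈ A i, x ≤ m := by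
        intro i
        have : (A i).Nonempty := by
          cases i
          · exact hBne
          · exact ⟨x0, hx0⟩
        obtain ⟨m, hm⟩ := (A i).exists_maximal this
        refine ⟨m, hm.1, fun x hx => ?_⟩
        have hm1 := (hA _ _).1 hm.1
        have hx1 := (hA _ _).1 hx
        rcases hs x hx1.1 m hm1.1 (by rw [hx1.2.1, hm1.2.1]) with h | h
        · exact h
        · exact hm.2 hx h
      choose m hm hmm using hmax
      have hm1 := fun i => (hA _ _).1 (hm i)
      have hanti : ∀ i, ¬ m i ≤ m (!i) := by
        intro i h
        obtain ⟨h1, h2, y, hy, h3, h4, h5⟩ := hm1 (!i)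
        have hyA : y ∈ A i := (hA _ _).2 ⟨hy, by revert h3; cases i <;> simp,
          m (!i), h1, by rw [h2]; cases i <;> simp, h5, h4⟩
        exact h5 ((hmm i y hyA).trans h)
      have hzm : ∃ i, m i ≤ z := by
        by_contra! hcon
        have hmT : ∀ i, m i ∈ T := fun i => Finset.mem_of_mem_erase (hm1 i).1
        have hzn : ∀ i, ¬ z ≤ m i := fun i h =>
          Finset.ne_of_mem_erase (hm1 i).1 (hzmax _ (hmT i) h)
        exact hw (m true) (hmT _) (m false) (hmT _) z hz.1 ⟨hanti true, hanti false⟩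
          ⟨hcon _, hzn _⟩ ⟨hcon _, hzn _⟩
      obtain ⟨i, hi⟩ := hzm
      refine ⟨fun x => decide (x = z ∨ (s x = i ∧ x ≤ m i)), fun x hx y hy hxy => ?_⟩
      rw [decide_eq_decide] at hxy
      by_cases hxz : x = z
      · subst hxz
        rcases hxy.1 (Or.inl rfl) with rfl | h
        · exact Or.inl le_rfl
        · exact Or.inr (h.2.trans hi)
      by_cases hyz : y = z
      · subst hyz
        rcases hxy.2 (Or.inl rfl) with rfl | h
        · exact Or.inl le_rfl
        · exact Or.inl (h.2.trans hi)
      have hx' : x ∈ T.erase z := Finset.mem_erase.2 ⟨hxz, hx⟩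
      have hy' : y ∈ T.erase z := Finset.mem_erase.2 ⟨hyz, hy⟩
      by_cases hsxy : s x = s y
      · exact hs x hx' y hy' hsxy
      by_contra! hcomp
      simp only [hxz, hyz, false_or] at hxy
      by_cases hsx : s x = i
      · have hsy : s y ≠ i := fun h => hsxy (hsx.trans h.symm)
        have hxA : x ∈ A i := (hA _ _).2 ⟨hx', hsx, y, hy', hsy, hcomp⟩
        exact hsy (hxy.1 ⟨hsx, hmm i x hxA⟩).1
      · have hsy : s y = i := by
          revert hsxy hsx; cases s x <;> cases s y <;> cases i <;> simp
        have hyA : y ∈ A i := (hA _ _).2 ⟨hy', hsy, x, hx', hsx, hcomp.2, hcomp.1⟩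
        exact hsx (hxy.2 ⟨hsy, hmm i y hyA⟩).1
    · refine ⟨fun x => decide (x = z), fun x hx y hy hxy => ?_⟩
      rw [decide_eq_decide] at hxy
      by_cases hxz : x = z
      · exact Or.inl (by rw [hxz, hxy.1 hxz])
      have hyz : y ≠ z := fun h => hxz (hxy.2 h)
      have hx' : x ∈ T.erase z := Finset.mem_erase.2 ⟨hxz, hx⟩
      have hy' : y ∈ T.erase z := Finset.mem_erase.2 ⟨hyz, hy⟩
      by_cases hsxy : s x = s y
      · exact hs x hx' y hy' hsxy
      by_contra! hcomp
      apply hAne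
      by_cases hsx : s x = true
      · exact ⟨x, (hA _ _).2 ⟨hx', hsx, y, hy', fun h => hsxy (hsx.trans h.symm), hcomp⟩⟩
      · exact ⟨y, (hA _ _).2 ⟨hy', by revert hsxy hsx; cases s x <;> cases s y <;> simp,
          x, hx', hsx, hcomp.2, hcomp.1⟩⟩

/-- `P` is not the ordinal sum of two nonempty parts. -/
def SumIndec (α : Type*) [PartialOrder α] : Prop :=
  ∀ S : Set α, S.Nonempty → Sᶜ.Nonempty → ∃ a ∈ S, ∃ b ∉ S, ¬ a < b

/-- `R x` is the largest element incomparable to `x`, on the other side of the coloring `s`. -/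
def IsMaxInc {α : Type*} [PartialOrder α] (s : α → Bool) (R : α → α) : Prop :=
  ∀ x, s (R x) ≠ s x ∧ ¬ x ≤ R x ∧ ¬ R x ≤ x ∧ ∀ z, ¬ x ≤ z → ¬ z ≤ x → z ≤ R x

theorem SumIndec.dual {α : Type*} [PartialOrder α] (h : SumIndec α) : SumIndec αᵒᵈ := by
  intro S h1 h2
  obtain ⟨a, ha, b, hb, hab⟩ := h (OrderDual.toDual ⁻¹' Sᶜ) h2
    (by rw [Set.preimage_compl, compl_compl]; exact h1)
  refine ⟨OrderDual.toDual b, ?_, OrderDual.toDual a, ha, hab⟩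
  simpa using hb

theorem SumIndec.exists_incomparable {α : Type*} [PartialOrder α] [Nontrivial α]
    (h : SumIndec α) (x : α) : ∃ y, ¬ x ≤ y ∧ ¬ y ≤ x := by
  by_contra! hx
  have hx' : ∀ y, x < y ∨ y ≤ x := fun y => by
    by_cases h1 : x ≤ y
    · rcases h1.lt_or_eq with h1 | h1
      · exact Or.inl h1
      · exact Or.inr h1.ge
    · exact Or.inr (hx y h1)
  by_cases hne : ({y | y ≤ x}ᶜ : Set α).Nonempty
  · obtain ⟨a, ha, b, hb, hab⟩ := h {y | y ≤ x} ⟨x, le_rfl⟩ hne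
    exact hab (lt_of_le_of_lt ha ((hx' b).resolve_right hb))
  · have hall : ∀ y, y ≤ x := fun y => by
      by_contra hy
      exact hne ⟨y, hy⟩
    obtain ⟨y, hy⟩ := exists_ne x
    obtain ⟨a, ha, b, hb, hab⟩ := h {y | y < x} ⟨y, lt_of_le_of_ne (hall y) hy⟩ ⟨x, lt_irrefl x⟩
    have hbx : b = x := by
      by_contra hbx
      exact hb (lt_of_le_of_ne (hall b) hbx)
    rw [hbx] at hab
    exact hab ha

theorem exists_isMaxInc {α : Type*} [PartialOrder α] [Finite α] [Nontrivial α]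
    (h : SumIndec α) (s : α → Bool) (hs : ∀ x y, s x = s y → x ≤ y ∨ y ≤ x) :
    ∃ R : α → α, IsMaxInc s R := by
  suffices H : ∀ x, ∃ y, s y ≠ s x ∧ ¬ x ≤ y ∧ ¬ y ≤ x ∧ ∀ z, ¬ x ≤ z → ¬ z ≤ x → z ≤ y by
    choose R hR using H
    exact ⟨R, hR⟩
  intro x
  obtain ⟨y, hy⟩ := ({y | ¬ x ≤ y ∧ ¬ y ≤ x} : Set α).toFinite.exists_maximal
    (h.exists_incomparable x)
  have hside : ∀ z, ¬ x ≤ z → ¬ z ≤ x → s z ≠ s x := by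
    intro z h1 h2 h3
    rcases hs z x h3 with h | h
    · exact h2 h
    · exact h1 h
  refine ⟨y, hside y hy.1.1 hy.1.2, hy.1.1, hy.1.2, fun z h1 h2 => ?_⟩
  have h3 := hside y hy.1.1 hy.1.2
  have h4 := hside z h1 h2
  rcases hs z y (by revert h3 h4; cases s x <;> cases s y <;> cases s z <;> simp) with h | h
  · exact h
  · exact hy.2 ⟨h1, h2⟩ h

theorem IsMaxInc.stall {α : Type*} [PartialOrder α] (h : SumIndec α) {s : α → Bool}
    (hs : ∀ x y, s x = s y → x ≤ y ∨ y ≤ x) {R : α → α} (hR : IsMaxInc s R) {x : α}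
    (hx : R (R x) = x) (z : α) : (s z = s x → z ≤ x) ∧ (s z ≠ s x → z ≤ R x) := by
  have h1 := hR x
  have h2 := hR (R x)
  rw [hx] at h2
  have hor : z ≤ x ∨ z ≤ R x := by
    by_contra hz
    obtain ⟨a, ha, b, hb, hab⟩ := h {z | z ≤ x ∨ z ≤ R x} ⟨x, Or.inl le_rfl⟩ ⟨z, hz⟩
    apply hab
    replace ha : a ≤ x ∨ a ≤ R x := ha
    replace hb : ¬ (b ≤ x ∨ b ≤ R x) := hb
    rw [not_or] at hb
    obtain ⟨hb1, hb2⟩ := hb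
    have hxb : x ≤ b := by
      by_contra hcon
      exact hb2 (h1.2.2.2 b hcon hb1)
    have hxb' : R x ≤ b := by
      by_contra hcon
      exact hb1 (h2.2.2.2 b hcon hb2)
    rcases ha with ha | ha
    · exact ha.trans_lt (lt_of_le_not_ge hxb hb1)
    · exact ha.trans_lt (lt_of_le_not_ge hxb' hb2)
  constructor
  · intro hsz
    rcases hor with h3 | h3
    · exact h3
    · rcases hs z x hsz with h4 | h4
      · exact h4
      · exact absurd (h4.trans h3) h1.2.1
  · intro hsz
    rcases hor with h3 | h3
    · have hsz' : s z = s (R x) := by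
        have := h1.1
        revert hsz this; cases s x <;> cases s (R x) <;> cases s z <;> simp
      rcases hs z (R x) hsz' with h4 | h4
      · exact h4
      · exact absurd (h4.trans h3) h1.2.2.1
    · exact h3

theorem exists_level {α : Type*} [PartialOrder α] [Finite α] [Nontrivial α] (h : SumIndec α)
    (s : α → Bool) (hs : ∀ x y, s x = s y → x ≤ y ∨ y ≤ x) :
    ∃ lev : α → ℤ, (∀ x y, s x = s y ↔ lev x % 2 = lev y % 2) ∧
      (∀ x y, s x = s y → x ≤ y → lev x ≤ lev y) ∧
      (∀ x y, s x ≠ s y → x ≤ y → lev x + 1 ≤ lev y) ∧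
      (∀ x y, s x ≠ s y → ¬ x ≤ y → lev y ≤ lev x + 1) := by
  classical
  obtain ⟨R, hR⟩ := exists_isMaxInc h s hs
  obtain ⟨x₀, hx₀⟩ := (Set.univ : Set α).toFinite.exists_minimal ⟨Classical.arbitrary α, trivial⟩
  have hmin : ∀ y, y ≤ x₀ → y = x₀ := fun y hy => le_antisymm hy (hx₀.2 trivial hy)
  let X : ℕ → α := fun i => R^[i] x₀
  have hX : ∀ i, X (i + 1) = R (X i) := fun i => Function.iterate_succ_apply' R i x₀
  have hne : ∀ {a b c : Bool}, a ≠ b → c ≠ b → a = c := by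
    intro a b c; cases a <;> cases b <;> cases c <;> simp
  have hs2 : ∀ i, s (X (i + 2)) = s (X i) := fun i =>
    hne (by rw [hX (i + 1)]; exact (hR _).1) (by rw [hX i]; exact (hR _).1.symm)
  have hle2 : ∀ i, X i ≤ X (i + 2) := fun i => by
    rw [hX (i + 1), hX i]
    exact (hR _).2.2.2 _ (hR (X i)).2.2.1 (hR (X i)).2.1
  have hspar : ∀ i, (s (X i) = s x₀ ↔ i % 2 = 0) := by
    intro i
    induction i with
    | zero => simp [X]
    | succ i ih =>
      have h1 := (hR (X i)).1
      rw [hX]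
      constructor
      · intro h2
        rw [h2] at h1
        have : ¬ i % 2 = 0 := fun h3 => h1 (ih.2 h3).symm
        omega
      · intro h2
        have : ¬ s (X i) = s x₀ := fun h3 => by
          have := ih.1 h3
          omega
        exact hne h1 (Ne.symm this)
  have hexists : ∀ z, ∃ i, s (X i) = s z ∧ z ≤ X i := by
    by_contra! hcon
    obtain ⟨z, hz⟩ := hcon
    have hall : ∀ i, X i ≠ X (i + 2) := by
      intro i hi
      have h1 := hR.stall h hs (x := X i) (by rw [← hX, ← hX]; exact hi.symm) z
      by_cases h2 : s z = s (X i)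
      · exact hz i h2.symm (h1.1 h2)
      · refine hz (i + 1) (hne ?_ h2) ?_
        · rw [hX]; exact (hR _).1
        · rw [hX]; exact h1.2 h2
    have hmono : StrictMono fun i => X (2 * i) :=
      strictMono_nat_of_lt_succ fun i => lt_of_le_of_ne (hle2 (2 * i)) (hall (2 * i))
    exact not_injective_infinite_finite _ hmono.injective
  have hle2k : ∀ k i, X i ≤ X (i + 2 * k) := by
    intro k i
    induction k with
    | zero => exact le_rfl
    | succ k ih => exact ih.trans (hle2 (i + 2 * k))
  let N : α → ℕ := fun z => Nat.find (hexists z)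
  have hN : ∀ z, s (X (N z)) = s z ∧ z ≤ X (N z) := fun z => Nat.find_spec (hexists z)
  have hNmin : ∀ z i, s (X i) = s z → z ≤ X i → N z ≤ i :=
    fun z i h1 h2 => Nat.find_min' (hexists z) ⟨h1, h2⟩
  have hpar : ∀ x y, s x = s y ↔ N x % 2 = N y % 2 := by
    intro x y
    rw [← (hN x).1, ← (hN y).1]
    have h1 := hspar (N x)
    have h2 := hspar (N y)
    constructor
    · intro h3
      rw [h3] at h1
      have := h1.symm.trans h2
      omega
    · intro h3
      rw [h3] at h1
      have := h1.trans h2.symm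
      revert this
      cases s (X (N x)) <;> cases s (X (N y)) <;> cases s x₀ <;> simp
  have hsucc : ∀ z i, s (X i) ≠ s z → s (X (i + 1)) = s z := fun z i h1 =>
    hne (by rw [hX]; exact (hR _).1) h1.symm
  refine ⟨fun z => N z, fun x y => ?_, fun x y h1 h2 => ?_, fun x y h1 h2 => ?_,
    fun x y h1 h2 => ?_⟩
  · rw [hpar]; beta_reduce; omega
  · beta_reduce
    exact_mod_cast hNmin x (N y) ((hN y).1.trans h1.symm) (h2.trans (hN y).2)
  · have h3 := hN y
    rcases hNy : N y with _ | j
    · rw [hNy] at h3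
      have h4 : y = x₀ := hmin y h3.2
      have h5 : x = x₀ := hmin x (h4 ▸ h2)
      exact absurd (by rw [h4, h5]) h1
    · rw [hNy] at h3
      have h4 : s (X j) = s x := hne (b := s y) (by rw [← h3.1, hX]; exact (hR _).1.symm) h1
      have h5 : x ≤ X j := by
        rcases hs x (X j) h4.symm with h5 | h5
        · exact h5
        · have := h5.trans (h2.trans h3.2)
          rw [hX] at this
          exact absurd this (hR _).2.1
      have := hNmin x j h4 h5
      push_cast
      omega
  · have h3 : s (X (N x + 1)) = s y := hsucc y _ (by rw [(hN x).1]; exact h1)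
    have h4 : y ≤ X (N x + 1) := by
      rcases hs y _ h3.symm with h4 | h4
      · exact h4
      by_contra hcon
      rw [hX] at h4 hcon
      by_cases h5 : X (N x) ≤ y
      · exact h2 ((hN x).2.trans h5)
      · by_cases h6 : y ≤ X (N x)
        · exact (hR _).2.2.1 (h4.trans h6)
        · exact hcon ((hR _).2.2.2 y h5 h6)
    beta_reduce
    exact_mod_cast hNmin y _ h3 h4

theorem exists_offset {α : Type*} [PartialOrder α] (lev : α → ℤ)
    (hl : ∀ x y, lev x = lev y → x ≤ y ∨ y ≤ x) (n : ℕ) :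
    ∀ T : Finset α, T.card = n → ∃ r : α → ℚ, ∀ x ∈ T, ∀ y ∈ T,
      (lev x = lev y → x < y → r x < r y) ∧
      (lev y = lev x + 1 → (x < y → r x < r y) ∧ (¬ x < y → r y < r x)) := by
  classical
  induction n with
  | zero =>
    intro T hT
    rw [Finset.card_eq_zero] at hT
    subst hT
    exact ⟨fun _ => 0, by simp⟩
  | succ n ih =>
    intro T hT
    have hne : T.Nonempty := by
      rw [← Finset.card_pos]; omega
    obtain ⟨z₀, hz₀, hz₀max⟩ := T.exists_max_image lev hne
    obtain ⟨z, hz⟩ := (T.filter fun x => lev x = lev z₀).exists_maximal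
      ⟨z₀, Finset.mem_filter.2 ⟨hz₀, rfl⟩⟩
    have hzT : z ∈ T := (Finset.mem_filter.1 hz.1).1
    have hzl : lev z = lev z₀ := (Finset.mem_filter.1 hz.1).2
    have hlez : ∀ x ∈ T, lev x ≤ lev z := fun x hx => hzl ▸ hz₀max x hx
    have hzmax : ∀ x ∈ T, lev x = lev z → x ≤ z := by
      intro x hx h
      rcases hl x z h with h1 | h1
      · exact h1
      · exact hz.2 (Finset.mem_filter.2 ⟨hx, h.trans hzl⟩) h1
    obtain ⟨r, hr⟩ := ih (T.erase z) (by rw [Finset.card_erase_of_mem hzT]; omega)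
    let lo : Finset ℚ := ((T.erase z).filter fun x => lev x = lev z).image r ∪
      ((T.erase z).filter fun x => lev z = lev x + 1 ∧ x < z).image r
    let hi : Finset ℚ := ((T.erase z).filter fun x => lev z = lev x + 1 ∧ ¬ x < z).image r
    have hlohi : ∀ p ∈ lo, ∀ q ∈ hi, p < q := by
      intro p hp q hq
      simp only [lo, hi, Finset.mem_union, Finset.mem_image, Finset.mem_filter] at hp hq
      obtain ⟨y, ⟨hy, hyl, hyz⟩, rfl⟩ := hq
      rcases hp with ⟨x, ⟨hx, hxl⟩, rfl⟩ | ⟨x, ⟨hx, hxl, hxz⟩, rfl⟩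
      · refine ((hr y hy x hx).2 (by omega)).2 fun h => hyz ?_
        exact h.trans_le (hzmax x (Finset.mem_of_mem_erase hx) hxl)
      · have hxy : lev x = lev y := by omega
        refine (hr x hx y hy).1 hxy ?_
        rcases hl x y hxy with h | h
        · exact lt_of_le_of_ne h fun h' => hyz (h' ▸ hxz)
        · exact absurd (h.trans_lt hxz) hyz
    obtain ⟨m, hm1, hm2⟩ := Order.exists_between_finsets lo hi hlohi
    have hma : ∀ x ∈ T.erase z, lev x = lev z → r x < m := fun x hx h => hm1 _ (by
      simp only [lo, Finset.mem_union, Finset.mem_image, Finset.mem_filter]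
      exact Or.inl ⟨x, ⟨hx, h⟩, rfl⟩)
    have hmb : ∀ x ∈ T.erase z, lev z = lev x + 1 → x < z → r x < m := fun x hx h h' => hm1 _ (by
      simp only [lo, Finset.mem_union, Finset.mem_image, Finset.mem_filter]
      exact Or.inr ⟨x, ⟨hx, h, h'⟩, rfl⟩)
    have hmc : ∀ x ∈ T.erase z, lev z = lev x + 1 → ¬ x < z → m < r x := fun x hx h h' => hm2 _ (by
      simp only [hi, Finset.mem_image, Finset.mem_filter]
      exact ⟨x, ⟨hx, h, h'⟩, rfl⟩)
    refine ⟨Function.update r z m, fun x hx y hy => ?_⟩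
    by_cases hxz : x = z
    · subst hxz
      refine ⟨fun h1 h2 => absurd h2 (hzmax y hy h1.symm).not_gt, fun h1 => ?_⟩
      have := hlez y hy
      omega
    · have hx' : x ∈ T.erase z := Finset.mem_erase.2 ⟨hxz, hx⟩
      by_cases hyz : y = z
      · subst hyz
        simp only [Function.update_self, Function.update_of_ne hxz]
        exact ⟨fun h1 _ => hma x hx' h1, fun h1 => ⟨hmb x hx' h1, hmc x hx' h1⟩⟩
      · simp only [Function.update_of_ne hxz, Function.update_of_ne hyz]
        exact hr x hx' y (Finset.mem_erase.2 ⟨hyz, hy⟩)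

/-- A finite sum-indecomposable poset covered by two chains is represented by integer levels and
small rational offsets. -/
theorem exists_rep {α : Type*} [PartialOrder α] [Finite α] [Nontrivial α] (h : SumIndec α)
    (s : α → Bool) (hs : ∀ x y, s x = s y → x ≤ y ∨ y ≤ x) :
    ∃ (lev : α → ℤ) (r : α → ℚ), (∀ x, |r x| < 1 / 2) ∧
      (∀ x y, s x = s y ↔ lev x % 2 = lev y % 2) ∧
      (∀ x y, x ≠ y → (lev x = lev y ∨ lev y = lev x + 1) → r x ≠ r y) ∧
      ∀ x y, x < y ↔ RLt s (fun z => lev z + r z) x y := by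
  classical
  cases nonempty_fintype α
  obtain ⟨lev, h1, h2, h3, h4⟩ := exists_level h s hs
  obtain ⟨q, hq⟩ := exists_offset lev (fun x y hxy => hs x y ((h1 x y).2 (by rw [hxy]))) _
    Finset.univ rfl
  replace hq := fun x y => hq x (Finset.mem_univ x) y (Finset.mem_univ y)
  obtain ⟨z, -, hz⟩ := (Finset.univ : Finset α).exists_max_image (fun x => |q x|)
    ⟨Classical.arbitrary α, Finset.mem_univ _⟩
  let M := 2 * |q z| + 1
  have hM : 0 < M := by positivity
  have hlt : ∀ x y, q x / M < q y / M ↔ q x < q y := fun x y => div_lt_div_iff_of_pos_right hM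
  have hbd : ∀ x, |q x / M| < 1 / 2 := by
    intro x
    rw [abs_div, abs_of_pos hM, div_lt_iff₀ hM]
    have := hz x (Finset.mem_univ x)
    simp only [M]
    linarith
  have hne : ∀ x y, x ≠ y → (lev x = lev y ∨ lev y = lev x + 1) → q x ≠ q y := by
    rintro x y hxy (hl | hl)
    · rcases hs x y ((h1 x y).2 (by rw [hl])) with h5 | h5
      · exact ((hq x y).1 hl (lt_of_le_of_ne h5 hxy)).ne
      · exact ((hq y x).1 hl.symm (lt_of_le_of_ne h5 hxy.symm)).ne'
    · by_cases h5 : x < y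
      · exact (((hq x y).2 hl).1 h5).ne
      · exact (((hq x y).2 hl).2 h5).ne'
  refine ⟨lev, fun x => q x / M, hbd, h1, fun x y hxy hl heq => ?_, fun x y => ?_⟩
  · exact hne x y hxy hl (by field_simp at heq; exact heq)
  have hbx := abs_lt.1 (hbd x)
  have hby := abs_lt.1 (hbd y)
  have hgt : ∀ k : ℤ, lev x + k ≤ lev y → (lev x : ℚ) + k ≤ lev y := fun k hk => by
    exact_mod_cast hk
  have hgt' : ∀ k : ℤ, lev y + k ≤ lev x → (lev y : ℚ) + k ≤ lev x := fun k hk => by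
    exact_mod_cast hk
  by_cases hxy : s x = s y
  · have hpar := (h1 x y).1 hxy
    simp only [RLt, hxy, true_and, ne_eq, not_true, false_and, or_false]
    rcases lt_trichotomy (lev x) (lev y) with hl | hl | hl
    · have := hgt 1 (by omega)
      push_cast at this
      refine iff_of_true ?_ (by linarith)
      rcases hs x y hxy with h5 | h5
      · exact lt_of_le_of_ne h5 fun h6 => by rw [h6] at hl; exact lt_irrefl _ hl
      · exact absurd (h2 y x hxy.symm h5) hl.not_ge
    · rw [hl, add_lt_add_iff_left, hlt]
      constructor
      · exact (hq x y).1 hl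
      · intro h5
        rcases hs x y hxy with h6 | h6
        · exact lt_of_le_of_ne h6 fun h7 => by rw [h7] at h5; exact lt_irrefl _ h5
        · rcases h6.lt_or_eq with h7 | h7
          · exact absurd ((hq y x).1 hl.symm h7) h5.not_gt
          · rw [h7] at h5; exact absurd h5 (lt_irrefl _)
    · have := hgt' 1 (by omega)
      push_cast at this
      refine iff_of_false (fun h5 => ?_) (by linarith)
      exact absurd (h2 x y hxy h5.le) hl.not_ge
  · have hpar : ¬ lev x % 2 = lev y % 2 := fun h5 => hxy ((h1 x y).2 h5)
    have hne' : x ≠ y := fun h5 => hxy (by rw [h5])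
    simp only [RLt, hxy, ne_eq, not_false_iff, true_and, false_and, false_or]
    rcases lt_trichotomy (lev y) (lev x + 1) with hl | hl | hl
    · have := hgt' 1 (by omega)
      push_cast at this
      refine iff_of_false (fun h5 => ?_) (by linarith)
      exact absurd (h3 x y hxy h5.le) hl.not_ge
    · have hcast : (lev y : ℚ) = lev x + 1 := by exact_mod_cast hl
      rw [hcast, add_right_comm, add_lt_add_iff_left, hlt]
      constructor
      · exact ((hq x y).2 hl).1
      · intro h5
        by_contra h6
        exact absurd (((hq x y).2 hl).2 h6) h5.not_gt
    · have := hgt 3 (by omega)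
      push_cast at this
      refine iff_of_true ?_ (by linarith)
      by_contra h5
      have := h4 x y hxy fun h6 => h5 (lt_of_le_of_ne h6 hne')
      omega

theorem RLt.trans {α : Type*} {s : α → Bool} {f : α → ℚ} {x y z : α}
    (h1 : RLt s f x y) (h2 : RLt s f y z) : RLt s f x z := by
  unfold RLt at *; grind

theorem RInc.symm {α : Type*} {s : α → Bool} {f : α → ℚ} {x y : α}
    (h : RInc s f x y) : RInc s f y x := ⟨h.1.symm, h.2.2, h.2.1⟩

theorem RInc.not_rlt {α : Type*} {s : α → Bool} {f : α → ℚ} {x y : α}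
    (h : RInc s f x y) : ¬ RLt s f x y := by
  unfold RLt RInc at *; grind

theorem RLt.asymm {α : Type*} {s : α → Bool} {f : α → ℚ} {x y : α}
    (h : RLt s f x y) : ¬ RLt s f y x := by
  unfold RLt at *; grind

/-- `R x` is the neighbour of `x` with the largest value of `f`, and iterating `R` only becomes
periodic at the top. -/
structure Greedy {α : Type*} (s : α → Bool) (f : α → ℚ) (R : α → α) : Prop where
  inj : ∀ x y, s x = s y → f x = f y → x = y
  inc : ∀ x, RInc s f x (R x)
  max : ∀ x z, RInc s f x z → f z ≤ f (R x)
  stall : ∀ x, R (R x) = x → ∀ z, (s z = s x → f z ≤ f x) ∧ (s z ≠ s x → f z ≤ f (R x))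

/-- The elements `y 0, …, y M` form an increasing zigzag: consecutive ones are incomparable and
the others are comparable. -/
def IsZigzag {α : Type*} (s : α → Bool) (f : α → ℚ) (y : ℕ → α) (M : ℕ) : Prop :=
  (∀ j, j + 1 ≤ M → RInc s f (y j) (y (j + 1))) ∧
  (∀ j, j + 2 ≤ M → RLt s f (y j) (y (j + 2))) ∧
  (∀ j, j + 3 ≤ M → RLt s f (y j) (y (j + 3)))

theorem IsZigzag.mono {α : Type*} {s : α → Bool} {f : α → ℚ} {y : ℕ → α} {M K : ℕ}
    (h : IsZigzag s f y M) (hK : K ≤ M) : IsZigzag s f y K :=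
  ⟨fun j hj => h.1 j (hj.trans hK), fun j hj => h.2.1 j (hj.trans hK),
    fun j hj => h.2.2 j (hj.trans hK)⟩

theorem IsZigzag.lt {α : Type*} {s : α → Bool} {f : α → ℚ} {y : ℕ → α} {M : ℕ}
    (h : IsZigzag s f y M) (i j : ℕ) (hij : i + 2 ≤ j) (hj : j ≤ M) : RLt s f (y i) (y j) := by
  induction j using Nat.strong_induction_on with
  | _ j ih =>
    rcases (by omega : j = i + 2 ∨ j = i + 3 ∨ i + 4 ≤ j) with rfl | rfl | h4
    · exact h.2.1 i hj
    · exact h.2.2 i hj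
    · have h5 := ih (j - 2) (by omega) (by omega) (by omega)
      have h6 := h.2.1 (j - 2) (by omega)
      rw [show j - 2 + 2 = j by omega] at h6
      exact h5.trans h6

theorem IsZigzag.lt_iff {α : Type*} {s : α → Bool} {f : α → ℚ} {y : ℕ → α} {M : ℕ}
    (h : IsZigzag s f y M) (i j : ℕ) (hi : i ≤ M) (hj : j ≤ M) :
    RLt s f (y i) (y j) ↔ i + 2 ≤ j := by
  refine ⟨fun h1 => ?_, fun h1 => h.lt i j h1 hj⟩
  by_contra h2
  rcases (by omega : j + 2 ≤ i ∨ j + 1 = i ∨ j = i ∨ j = i + 1) with h3 | rfl | rfl | rfl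
  · exact (h.lt j i h3 hi).asymm h1
  · exact (h.1 j hi).symm.not_rlt h1
  · exact h1.asymm h1
  · exact (h.1 i hj).not_rlt h1

theorem IsZigzag.cons {α : Type*} {s : α → Bool} {f : α → ℚ} {y : ℕ → α} {M : ℕ} {e : α}
    (h : IsZigzag s f y M) (h0 : RInc s f e (y 0)) (h1 : RLt s f e (y 1))
    (h2 : RLt s f e (y 2)) : IsZigzag s f (fun j => Nat.casesOn j e y) (M + 1) := by
  refine ⟨fun j hj => ?_, fun j hj => ?_, fun j hj => ?_⟩
  · cases j with
    | zero => exact h0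
    | succ j => exact h.1 j (by omega)
  · cases j with
    | zero => exact h1
    | succ j => exact h.2.1 j (by omega)
  · cases j with
    | zero => exact h2
    | succ j => exact h.2.2 j (by omega)

theorem IsZigzag.snoc {α : Type*} {s : α → Bool} {f : α → ℚ} {y : ℕ → α} {M : ℕ} {e : α}
    (h : IsZigzag s f y (M + 2)) (h0 : RInc s f (y (M + 2)) e) (h1 : RLt s f (y (M + 1)) e)
    (h2 : RLt s f (y M) e) : IsZigzag s f (Function.update y (M + 3) e) (M + 3) := by
  refine ⟨fun j hj => ?_, fun j hj => ?_, fun j hj => ?_⟩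
  · rw [Function.update_of_ne (by omega)]
    by_cases hj' : j + 1 = M + 3
    · rw [hj', Function.update_self]
      rwa [show j = M + 2 by omega]
    · rw [Function.update_of_ne hj']
      exact h.1 j (by omega)
  · rw [Function.update_of_ne (by omega)]
    by_cases hj' : j + 2 = M + 3
    · rw [hj', Function.update_self]
      rwa [show j = M + 1 by omega]
    · rw [Function.update_of_ne hj']
      exact h.2.1 j (by omega)
  · rw [Function.update_of_ne (by omega)]
    by_cases hj' : j + 3 = M + 3
    · rw [hj', Function.update_self]
      rwa [show j = M by omega]
    · rw [Function.update_of_ne hj']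
      exact h.2.2 j (by omega)

theorem Greedy.side_two {α : Type*} {s : α → Bool} {f : α → ℚ} {R : α → α}
    (G : Greedy s f R) (x : α) : s (R (R x)) = s x := by
  have h1 := (G.inc x).1
  have h2 := (G.inc (R x)).1
  revert h1 h2
  cases s x <;> cases s (R x) <;> cases s (R (R x)) <;> simp

theorem Greedy.le_two {α : Type*} {s : α → Bool} {f : α → ℚ} {R : α → α}
    (G : Greedy s f R) (x : α) : f x ≤ f (R (R x)) := G.max _ _ (G.inc x).symm

theorem Greedy.isZigzag {α : Type*} {s : α → Bool} {f : α → ℚ} {R : α → α}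
    (G : Greedy s f R) {x : ℕ → α} (hx : ∀ j, x (j + 1) = R (x j)) {M : ℕ}
    (hM : ∀ j, j + 2 ≤ M → x (j + 2) ≠ x j) : IsZigzag s f x M := by
  have h2 : ∀ j, j + 2 ≤ M → s (x j) = s (x (j + 2)) ∧ f (x j) < f (x (j + 2)) := by
    intro j hj
    have h3 : s (x (j + 2)) = s (x j) := by rw [hx, hx]; exact G.side_two _
    refine ⟨h3.symm, lt_of_le_of_ne ?_ fun h => hM j hj (G.inj _ _ h3 h.symm)⟩
    rw [hx (j + 1), hx]
    exact G.le_two _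
  refine ⟨fun j hj => by rw [hx]; exact G.inc _, fun j hj => Or.inl (h2 j hj), fun j hj => ?_⟩
  have h3 := G.inc (x j)
  have h4 := G.max (x j) (x (j + 3))
  rw [← hx] at h3 h4
  have h5 := h2 (j + 1) (by omega)
  rw [show j + 1 + 2 = j + 3 by omega] at h5
  unfold RInc RLt at *
  grind

/-- Three elements are incomparable to `u`. -/
def Claw {α : Type*} (s : α → Bool) (f : α → ℚ) (u : α) : Prop :=
  ∃ a b c, RInc s f u a ∧ RInc s f u b ∧ RInc s f u c ∧ f a < f b ∧ f b < f c

/-- The zigzag `q 1, …, q (n + 4)` with its two ends doubled by `q 0` and `q (n + 5)`. -/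
def IsForked {α : Type*} (s : α → Bool) (f : α → ℚ) (q : ℕ → α) (n : ℕ) : Prop :=
  IsZigzag s f (fun j => q (j + 1)) (n + 3) ∧ RLt s f (q 0) (q 1) ∧ RInc s f (q 0) (q 2) ∧
    RLt s f (q (n + 4)) (q (n + 5)) ∧ RInc s f (q (n + 3)) (q (n + 5))

theorem IsZigzag.isForked {α : Type*} {s : α → Bool} {f : α → ℚ} {y : ℕ → α} {n : ℕ} {e t : α}
    (h : IsZigzag s f y (n + 3)) (h1 : RLt s f e (y 0)) (h2 : RInc s f e (y 1))
    (h3 : RLt s f (y (n + 3)) t) (h4 : RInc s f (y (n + 2)) t) :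
    ∃ q : ℕ → α, IsForked s f q n := by
  refine ⟨fun j => Nat.casesOn j e (Function.update y (n + 4) t), ⟨?_, ?_, ?_⟩, ?_, ?_, ?_, ?_⟩
  · intro j hj
    simp only [Function.update_of_ne (show j ≠ n + 4 by omega),
      Function.update_of_ne (show j + 1 ≠ n + 4 by omega)]
    exact h.1 j hj
  · intro j hj
    simp only [Function.update_of_ne (show j ≠ n + 4 by omega),
      Function.update_of_ne (show j + 2 ≠ n + 4 by omega)]
    exact h.2.1 j hj
  · intro j hj
    simp only [Function.update_of_ne (show j ≠ n + 4 by omega),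
      Function.update_of_ne (show j + 3 ≠ n + 4 by omega)]
    exact h.2.2 j hj
  · simp only
    exact h1
  · simp only
    exact h2
  · simp only [Function.update_of_ne (show n + 3 ≠ n + 4 by omega), Function.update_self]
    exact h3
  · simp only [Function.update_of_ne (show n + 2 ≠ n + 4 by omega), Function.update_self]
    exact h4

theorem Greedy.exists_zigzag_end {α : Type*} {s : α → Bool} {f : α → ℚ} {R : α → α}
    (G : Greedy s f R) {y : ℕ → α} {M : ℕ} (hy : IsZigzag s f y (M + 3))
    (hR : ∀ j, M ≤ j → j ≤ M + 2 → y (j + 1) = R (y j)) {v : α} (hv : Claw s f v)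
    (h1 : RInc s f (y (M + 3)) v) (h2 : RLt s f (y (M + 2)) v) (h3 : RLt s f (y (M + 1)) v) :
    ∃ y' M' t, M ≤ M' ∧ IsZigzag s f y' (M' + 3) ∧ y' 0 = y 0 ∧ y' 1 = y 1 ∧
      RLt s f (y' (M' + 3)) t ∧ RInc s f (y' (M' + 2)) t := by
  obtain ⟨b, b', b'', hb, hb', hb'', hbb', hbb''⟩ := hv
  have m1 := G.max (y (M + 2))
  have m2 := G.max (y (M + 1))
  have m3 := G.max (y M)
  rw [← hR _ (by omega) (by omega)] at m1 m2 m3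
  have z1 := hy.1 M (by omega)
  have z2 := hy.1 (M + 1) (by omega)
  have z3 := hy.1 (M + 2) (by omega)
  have l1 := hy.2.1 M (by omega)
  have l2 := hy.2.1 (M + 1) (by omega)
  have hs : ∀ x, s x = true ∨ s x = false := fun x => by cases s x <;> simp
  by_cases hc : f (y (M + 3)) < f b'
  · have hy1 : IsZigzag s f (Function.update y (M + 4) v) (M + 4) := hy.snoc h1 h2 h3
    have e4 : Function.update y (M + 4) v (M + 4) = v := Function.update_self ..
    have e3 : Function.update y (M + 4) v (M + 3) = y (M + 3) :=
      Function.update_of_ne (by omega) ..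
    have e2 : Function.update y (M + 4) v (M + 2) = y (M + 2) :=
      Function.update_of_ne (by omega) ..
    have hy2 := IsZigzag.snoc (M := M + 2) (e := b') hy1 (by rw [e4]; exact hb')
      (by
        rw [e3]
        clear m1 m2 m3 hR hy hy1 e4 e3 e2
        unfold RInc RLt at *; grind)
      (by
        rw [e2]
        have := m1 b'
        clear m1 m2 m3 hR hy hy1 e4 e3 e2
        unfold RInc RLt at *; grind)
    refine ⟨_, M + 2, b'', by omega, hy2, ?_, ?_, ?_, ?_⟩
    · simp
    · simp
    · rw [Function.update_self]
      exact Or.inl (by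
        clear m1 m2 m3 hR hy hy1 hy2 e4 e3 e2
        unfold RInc RLt at *; grind)
    · rw [Function.update_of_ne (by omega), e4]
      exact hb''
  · have hb2 : RInc s f (y (M + 2)) b := by
      clear m1 m2 m3 hR hy
      unfold RInc RLt at *; grind
    have hb2' : RInc s f (y (M + 2)) b' := by
      clear m1 m2 m3 hR hy
      unfold RInc RLt at *; grind
    have hb1 : RLt s f (y (M + 1)) b := by
      clear m1 m2 m3 hR hy
      unfold RInc RLt at *; grind
    have hb0 : RLt s f (y M) b := by
      have := m3 b
      clear m1 m2 m3 hR hy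
      unfold RInc RLt at *; grind
    refine ⟨_, M, b', le_rfl, (hy.mono (by omega)).snoc hb2 hb1 hb0, ?_, ?_, ?_, ?_⟩
    · simp
    · simp
    · rw [Function.update_self]
      exact Or.inl (by
        clear m1 m2 m3 hR hy hb1 hb0
        unfold RInc RLt at *; grind)
    · rw [Function.update_of_ne (by omega)]
      exact hb2'

theorem Greedy.iterate_le {α : Type*} {s : α → Bool} {f : α → ℚ} {R : α → α}
    (G : Greedy s f R) (u : α) (j : ℕ) : f (R^[j] u) ≤ f u + j := by
  induction j with
  | zero => simp
  | succ j ih =>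
    rw [Function.iterate_succ_apply']
    have := (G.inc (R^[j] u)).2.2
    push_cast
    linarith

theorem Greedy.ne_of_rlt {α : Type*} {s : α → Bool} {f : α → ℚ} {R : α → α}
    (G : Greedy s f R) {x v : α} (h : RLt s f x v) : R (R x) ≠ x := by
  intro hx
  have h1 := G.stall x hx v
  have h2 := (G.inc x).2.2
  rcases h with h | h
  · have := h1.1 h.1.symm
    linarith [h.2]
  · have := h1.2 (Ne.symm h.1)
    linarith [h.2]

theorem RInc.of_greedy_step {α : Type*} {s : α → Bool} {f : α → ℚ} {x y v : α}
    (h : RInc s f x y) (h1 : RLt s f x v) (h2 : ¬ RLt s f y v) : RInc s f y v := by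
  have hs : ∀ x, s x = true ∨ s x = false := fun x => by cases s x <;> simp
  unfold RInc RLt at *
  grind

theorem Greedy.exists_forked {α : Type*} [Finite α] {s : α → Bool} {f : α → ℚ} {R : α → α}
    (G : Greedy s f R) {u v : α} {k : ℕ} (hu : Claw s f u) (hv : Claw s f v)
    (huv : f u + k + 10 < f v) : ∃ n, k ≤ n ∧ ∃ q, IsForked s f q n := by
  classical
  have hxs : ∀ j, R^[j + 1] u = R (R^[j] u) := fun j => Function.iterate_succ_apply' R j u
  have hne : ∀ j, RLt s f (R^[j] u) v → R^[j + 2] u ≠ R^[j] u := fun j hj => by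
    rw [hxs, hxs]
    exact G.ne_of_rlt hj
  have hex : ∃ i, ¬ RLt s f (R^[i] u) v := by
    by_contra! hall
    refine not_injective_infinite_finite (fun i : ℕ => R^[2 * i] u) fun i j hij => ?_
    have hz := G.isZigzag (x := fun j => R^[j] u) hxs (M := 2 * i + 2 * j)
      fun j _ => hne j (hall j)
    simp only at hij
    by_contra hij'
    rcases Nat.lt_or_gt_of_ne hij' with h | h
    · have h1 := hz.lt (2 * i) (2 * j) (by omega) (by omega)
      simp only [hij] at h1
      exact h1.asymm h1
    · have h1 := hz.lt (2 * j) (2 * i) (by omega) (by omega)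
      simp only [hij] at h1
      exact h1.asymm h1
  obtain ⟨m, hm, hmin⟩ : ∃ m, ¬ RLt s f (R^[m] u) v ∧ ∀ j < m, RLt s f (R^[j] u) v :=
    ⟨Nat.find hex, Nat.find_spec hex, fun j hj => not_not.1 (Nat.find_min hex hj)⟩
  have hmk : k + 9 ≤ m := by
    have h1 := G.iterate_le u m
    have h2 : f v ≤ f (R^[m] u) + 1 := by
      by_contra! h
      refine hm ?_
      by_cases hs : s (R^[m] u) = s v
      · exact Or.inl ⟨hs, by linarith⟩
      · exact Or.inr ⟨hs, h⟩
    have h3 : (k + 9 : ℚ) ≤ m := by linarith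
    exact_mod_cast h3
  obtain ⟨c, rfl⟩ : ∃ c, m = c + 9 := ⟨m - 9, by omega⟩
  have hz : IsZigzag s f (fun j => R^[j] u) (c + 9) :=
    G.isZigzag hxs fun j hj => hne j (hmin j (by omega))
  have hinc : RInc s f (R^[c + 9] u) v := by
    refine RInc.of_greedy_step ?_ (hmin (c + 8) (by omega)) hm
    rw [hxs (c + 8)]
    exact G.inc _
  have l1 := hmin (c + 8) (by omega)
  have l2 := hmin (c + 7) (by omega)
  obtain ⟨a, a', a'', ha, ha', ha'', haa', haa''⟩ := hu
  have hm1 := G.max u a'' ha''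
  have hm2 := G.le_two u
  have hr := G.inc u
  have hs : ∀ x, s x = true ∨ s x = false := fun x => by cases s x <;> simp
  have ha1 : RLt s f a' (R u) := Or.inl (by
    clear hmin hne hex hxs hz G
    unfold RInc at *
    grind)
  by_cases hc : RLt s f a' (R (R u))
  · have hy := hz.cons ha'.symm ha1 hc
    obtain ⟨y', M', t, hM, hy', e0, e1, ht, ht'⟩ := G.exists_zigzag_end (M := c + 7) hy
      (fun j hj _ => by
        obtain ⟨j, rfl⟩ : ∃ i, j = i + 1 := ⟨j - 1, by omega⟩
        exact hxs j) hv hinc l1 l2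
    refine ⟨M', by omega, hy'.isForked (e := a) ?_ ?_ ht ht'⟩
    · rw [e0]
      have h1 := ha.1
      have h2 := ha'.1
      refine Or.inl ⟨?_, haa'⟩
      change s a = s a'
      clear hmin hne hex hxs hz hy hy' G e0 e1
      grind
    · rw [e1]
      exact ha.symm
  · have hy : IsZigzag s f (fun j => R^[j + 1] u) (c + 5 + 3) :=
      ⟨fun j hj => hz.1 (j + 1) (by omega), fun j hj => hz.2.1 (j + 1) (by omega),
        fun j hj => hz.2.2 (j + 1) (by omega)⟩
    obtain ⟨y', M', t, hM, hy', e0, e1, ht, ht'⟩ := G.exists_zigzag_end hy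
      (fun j hj _ => hxs (j + 1)) hv hinc l1 l2
    refine ⟨M', by omega, hy'.isForked (e := a') ?_ ?_ ht ht'⟩
    · rw [e0]
      exact ha1
    · rw [e1]
      have h2 := G.side_two u
      change RInc s f a' (R (R u))
      clear hmin hne hex hxs hz hy hy' G
      unfold RInc RLt at *
      grind

/-- For `i < j ≤ N`, incomparability of `i` and `j` in the fork on `0, …, N`. -/
def ForkInc (N i j : ℕ) : Prop :=
  (i = 0 ∧ j = 2) ∨ (1 ≤ i ∧ i + 1 = j ∧ j < N) ∨ (i + 2 = N ∧ j = N)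

/-- The fork: a zigzag whose two ends are doubled. -/
def fork (n : ℕ) : FinPoset :=
  ⟨n + 6,
    { le := fun i j => i = j ∨ (i.1 < j.1 ∧ ¬ ForkInc (n + 5) i.1 j.1)
      lt := fun i j => (i = j ∨ (i.1 < j.1 ∧ ¬ ForkInc (n + 5) i.1 j.1)) ∧
        ¬ (j = i ∨ (j.1 < i.1 ∧ ¬ ForkInc (n + 5) j.1 i.1))
      lt_iff_le_not_ge := fun _ _ => Iff.rfl
      le_refl := fun i => Or.inl rfl
      le_trans := by
        rintro i j k (rfl | h1) (rfl | h2)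
        · exact Or.inl rfl
        · exact Or.inr h2
        · exact Or.inr h1
        · right
          unfold ForkInc at *
          omega
      le_antisymm := by
        rintro i j (rfl | h1) (h2 | h2)
        · rfl
        · rfl
        · exact h2.symm
        · omega }⟩

theorem fork_le {n : ℕ} (i j : Fin (fork n).1) : (fork n).2.le i j ↔
    i = j ∨ (i.1 < j.1 ∧ ¬ ForkInc (n + 5) i.1 j.1) := Iff.rfl

theorem IsForked.inc {α : Type*} {s : α → Bool} {f : α → ℚ} {q : ℕ → α} {n : ℕ}
    (h : IsForked s f q n) {i j : ℕ} (hij : ForkInc (n + 5) i j) : RInc s f (q i) (q j) := by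
  obtain ⟨hz, h1, h2, h3, h4⟩ := h
  rcases hij with ⟨rfl, rfl⟩ | ⟨hi, rfl, hj⟩ | ⟨hi, rfl⟩
  · exact h2
  · obtain ⟨i, rfl⟩ : ∃ k, i = k + 1 := ⟨i - 1, by omega⟩
    exact hz.1 i (by omega)
  · rw [show i = n + 3 by omega]
    exact h4

theorem IsForked.rlt {α : Type*} {s : α → Bool} {f : α → ℚ} {q : ℕ → α} {n : ℕ}
    (h : IsForked s f q n) {i j : ℕ} (hlt : i < j) (hj : j ≤ n + 5)
    (hij : ¬ ForkInc (n + 5) i j) : RLt s f (q i) (q j) := by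
  obtain ⟨hz, h1, h2, h3, h4⟩ := h
  have key : ∀ a b, 1 ≤ a → a + 2 ≤ b → b ≤ n + 4 → RLt s f (q a) (q b) := by
    intro a b ha hab hb
    obtain ⟨a, rfl⟩ : ∃ k, a = k + 1 := ⟨a - 1, by omega⟩
    obtain ⟨b, rfl⟩ : ∃ k, b = k + 1 := ⟨b - 1, by omega⟩
    exact hz.lt a b (by omega) (by omega)
  have key0 : ∀ b, b = 1 ∨ 3 ≤ b → b ≤ n + 4 → RLt s f (q 0) (q b) := by
    rintro b (rfl | hb) hb'
    · exact h1
    · exact h1.trans (key 1 b le_rfl hb hb')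
  unfold ForkInc at hij
  by_cases hj5 : j = n + 5
  · subst hj5
    by_cases hi4 : i = n + 4
    · subst hi4
      exact h3
    · refine RLt.trans ?_ h3
      by_cases hi0 : i = 0
      · subst hi0
        exact key0 _ (by omega) le_rfl
      · exact key _ _ (by omega) (by omega) le_rfl
  · by_cases hi0 : i = 0
    · subst hi0
      exact key0 _ (by omega) (by omega)
    · exact key _ _ (by omega) (by omega) (by omega)

theorem IsForked.pemb {P : FinPoset} {s : Fin P.1 → Bool} {f : Fin P.1 → ℚ} {q : ℕ → Fin P.1}
    {n : ℕ} (h : IsForked s f q n) (hlt : ∀ x y, P.2.lt x y ↔ RLt s f x y) :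
    PEmb (fork n) P := by
  have lt_iff : ∀ x y : Fin P.1, P.2.lt x y ↔ P.2.le x y ∧ x ≠ y :=
    fun x y => @lt_iff_le_and_ne _ P.2 x y
  have hlt' : ∀ i j : Fin (fork n).1, i.1 < j.1 → ¬ ForkInc (n + 5) i.1 j.1 →
      P.2.lt (q i.1) (q j.1) := fun i j h1 h2 => by
    have hj : j.1 < n + 6 := j.2
    exact (hlt _ _).2 (h.rlt h1 (by omega) h2)
  have hinc : ∀ i j : ℕ, ForkInc (n + 5) i j →
      ¬ P.2.le (q i) (q j) ∧ ¬ P.2.le (q j) (q i) := fun i j h1 => by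
    have h2 := h.inc h1
    have h3 : q i ≠ q j := fun h => h2.1 (by rw [h])
    refine ⟨fun h4 => ?_, fun h4 => ?_⟩
    · exact h2.not_rlt ((hlt _ _).1 ((lt_iff _ _).2 ⟨h4, h3⟩))
    · exact h2.symm.not_rlt ((hlt _ _).1 ((lt_iff _ _).2 ⟨h4, h3.symm⟩))
  have main : ∀ i j : Fin (fork n).1, (fork n).2.le i j ↔
      P.2.le (q i.1) (q j.1) := by
    intro i j
    rw [fork_le]
    constructor
    · rintro (rfl | h1)
      · exact @le_refl _ P.2.toPreorder _
      · exact ((lt_iff _ _).1 (hlt' _ _ h1.1 h1.2)).1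
    · intro h1
      rcases lt_trichotomy i.1 j.1 with h2 | h2 | h2
      · exact Or.inr ⟨h2, fun h3 => (hinc _ _ h3).1 h1⟩
      · exact Or.inl (Fin.ext h2)
      · exfalso
        by_cases h3 : ForkInc (n + 5) j.1 i.1
        · exact (hinc _ _ h3).2 h1
        · have h4 := (lt_iff _ _).1 (hlt' _ _ h2 h3)
          exact h4.2 (@le_antisymm _ P.2 _ _ h4.1 h1)
  refine ⟨fun i => q i.1, fun i j hij => ?_, main⟩
  simp only at hij
  exact @le_antisymm _ (fork n).2 i j
    ((main i j).2 (by rw [hij]; exact @le_refl _ P.2.toPreorder _))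
    ((main j i).2 (by rw [hij]; exact @le_refl _ P.2.toPreorder _))

theorem le_of_pemb_fork {n m : ℕ} (h : PEmb (fork n) (fork m)) : m ≤ n := by
  obtain ⟨g, hg, hle⟩ := h
  change Fin (n + 6) → Fin (m + 6) at g
  change Function.Injective g at hg
  replace hle : ∀ i j : Fin (n + 6), (i = j ∨ (i.1 < j.1 ∧ ¬ ForkInc (n + 5) i.1 j.1)) ↔
      (g i = g j ∨ ((g i).1 < (g j).1 ∧ ¬ ForkInc (m + 5) (g i).1 (g j).1)) := hle
  have hinc : ∀ i j : Fin (n + 6), ForkInc (n + 5) i.1 j.1 →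
      ForkInc (m + 5) (g i).1 (g j).1 ∨ ForkInc (m + 5) (g j).1 (g i).1 := by
    intro i j hij
    have hne : i.1 < j.1 := by unfold ForkInc at hij; omega
    have h1 : ¬ (g i = g j ∨ ((g i).1 < (g j).1 ∧ ¬ ForkInc (m + 5) (g i).1 (g j).1)) := by
      rw [← hle i j]
      rintro (rfl | h)
      · exact lt_irrefl _ hne
      · exact h.2 hij
    have h2 : ¬ (g j = g i ∨ ((g j).1 < (g i).1 ∧ ¬ ForkInc (m + 5) (g j).1 (g i).1)) := by
      rw [← hle j i]
      rintro (rfl | h)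
      · exact lt_irrefl _ hne
      · omega
    have h3 : (g i).1 ≠ (g j).1 := fun h => h1 (Or.inl (Fin.ext h))
    by_contra! h4
    rcases Nat.lt_or_gt_of_ne h3 with h5 | h5
    · exact h1 (Or.inr ⟨h5, h4.1⟩)
    · exact h2 (Or.inr ⟨h5, h4.2⟩)
  set G : ℕ → ℕ := fun i => if h : i < n + 6 then (g ⟨i, h⟩).1 else 0 with hG
  have hinc' : ∀ i j, ForkInc (n + 5) i j →
      ForkInc (m + 5) (G i) (G j) ∨ ForkInc (m + 5) (G j) (G i) := by
    intro i j hij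
    have h1 : i < n + 6 := by unfold ForkInc at hij; omega
    have h2 : j < n + 6 := by unfold ForkInc at hij; omega
    simp only [hG, h1, h2, dite_true]
    exact hinc ⟨i, h1⟩ ⟨j, h2⟩ hij
  have hinj : ∀ i j, i < n + 6 → j < n + 6 → i ≠ j → G i ≠ G j := by
    intro i j h1 h2 hne h
    simp only [hG, h1, h2, dite_true] at h
    have := hg (Fin.ext h)
    simp only [Fin.mk.injEq] at this
    exact hne this
  have claw : ∀ c x y z, (∀ w, w = x ∨ w = y ∨ w = z → ForkInc (n + 5) c w ∨
      ForkInc (n + 5) w c) → x ≠ y → x ≠ z → y ≠ z → x < n + 6 → y < n + 6 → z < n + 6 →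
      G c = 2 ∨ G c = m + 3 := by
    intro c x y z hw h1 h2 h3 hx hy hz
    have a1 := hinj x y hx hy h1
    have a2 := hinj x z hx hz h2
    have a3 := hinj y z hy hz h3
    have k : ∀ w, w = x ∨ w = y ∨ w = z → ForkInc (m + 5) (G c) (G w) ∨
        ForkInc (m + 5) (G w) (G c) := fun w hw' => by
      rcases hw w hw' with h | h
      · exact hinc' _ _ h
      · exact (hinc' _ _ h).symm
    have b1 := k x (by simp)
    have b2 := k y (by simp)
    have b3 := k z (by simp)
    unfold ForkInc at b1 b2 b3
    omega
  have c1 := claw 2 0 1 3 (by unfold ForkInc; omega) (by omega) (by omega) (by omega) (by omega)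
    (by omega) (by omega)
  have c2 := claw (n + 3) (n + 2) (n + 4) (n + 5) (by unfold ForkInc; omega) (by omega)
    (by omega) (by omega) (by omega) (by omega) (by omega)
  have c3 := hinj 2 (n + 3) (by omega) (by omega) (by omega)
  have step : ∀ j, j ≤ n + 1 → max 1 (min (G (j + 2)) (m + 4)) ≤ max 1 (min (G 2) (m + 4)) + j ∧
      max 1 (min (G 2) (m + 4)) ≤ max 1 (min (G (j + 2)) (m + 4)) + j := by
    intro j
    induction j with
    | zero => simp
    | succ j ih =>
      intro hj
      have h1 := ih (by omega)
      have h2 := hinc' (j + 2) (j + 1 + 2) (by unfold ForkInc; omega)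
      unfold ForkInc at h2
      omega
  have h1 := step (n + 1) le_rfl
  rw [show n + 1 + 2 = n + 3 by omega] at h1
  omega

theorem Greedy.le_of_not_claw {α : Type*} {s : α → Bool} {f : α → ℚ} {R : α → α}
    (G : Greedy s f R) {v : α} (hv : ∀ x, f v < f x → ¬ Claw s f x) {y : ℕ → α}
    (hy : ∀ j, y (j + 1) = R (y j)) {m : ℕ} (hz : IsZigzag s f y (m + 1)) (h0 : y 0 = v)
    (hm : y (m + 2) = y m) {z : α} (hzy : ∀ j, 3 ≤ j → j ≤ m + 1 → y j ≠ z) (i : ℕ)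
    (hi : i + 1 ≤ m) :
    (s z = s (y (m - i)) → f z ≤ f (y (m - i))) ∧
      (s z ≠ s (y (m - i)) → f z ≤ f (y (m - i + 1))) := by
  have hs : ∀ x, s x = true ∨ s x = false := fun x => by cases s x <;> simp
  induction i with
  | zero =>
    have h := G.stall (y m) (by rw [← hy, ← hy]; exact hm) z
    rw [← hy] at h
    exact h
  | succ i ih =>
    obtain ⟨h1, h2⟩ := ih (by omega)
    obtain ⟨j, hj⟩ : ∃ j, m - (i + 1) = j + 1 := ⟨m - (i + 1) - 1, by omega⟩
    rw [show m - i = j + 2 by omega] at h1 h2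
    rw [hj]
    have z1 := hz.1 (j + 1) (by omega)
    have z2 := hz.1 (j + 2) (by omega)
    have z3 := hz.2.1 (j + 1) (by omega)
    have z4 : f v < f (y (j + 2)) := by
      have h3 := hz.lt 0 (j + 2) (by omega) (by omega)
      rw [h0] at h3
      rcases h3 with h3 | h3 <;> linarith [h3.2]
    refine ⟨fun h3 => ?_, fun h3 => ?_⟩
    · by_contra! h4
      have h5 := h2 (by
        intro h5
        exact z1.1 (h3.symm.trans h5))
      have h6 : s z = s (y (j + 3)) := by
        clear hy hz hm hzy h1 h2
        unfold RInc at z1 z2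
        grind
      have h7 := lt_of_le_of_ne h5 fun h => hzy (j + 3) (by omega) (by omega)
        (G.inj _ _ h6.symm h.symm)
      refine hv _ z4 ⟨y (j + 1), z, y (j + 3), z1.symm, ⟨?_, ?_, ?_⟩, z2, h4, h7⟩
      · rw [h3]
        exact z1.1.symm
      · linarith [z1.2.2]
      · linarith [z2.2.2]
    · refine h1 ?_
      clear hy hz hm hzy h1 h2
      unfold RInc at z1
      grind

theorem Greedy.exists_path {α : Type*} [Finite α] {s : α → Bool} {f : α → ℚ} {R : α → α}
    (G : Greedy s f R) {v : α} (hv : ∀ x, f v < f x → ¬ Claw s f x) :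
    ∃ r : α → ℕ, (∀ x y, r x = r y → 1 ≤ r x → x = y) ∧ (∀ x, 1 ≤ r x → f v < f x) ∧
      (∀ x, r x ≤ 1 → f x ≤ f v + 4) ∧
      (∀ x y, 2 ≤ r x ∨ 2 ≤ r y → (RLt s f x y ↔ r x + 2 ≤ r y)) ∧
      (∀ x i, r x = i + 2 → ∃ y, r y = i + 1) := by
  classical
  set y : ℕ → α := fun j => R^[j] v with hyd
  have hy : ∀ j, y (j + 1) = R (y j) := fun j => Function.iterate_succ_apply' R j v
  have hex : ∃ m, y (m + 2) = y m := by
    by_contra! hall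
    refine not_injective_infinite_finite (fun i : ℕ => y (2 * i)) fun i j hij => ?_
    have hz := G.isZigzag hy (M := 2 * i + 2 * j) fun j _ => hall j
    simp only at hij
    by_contra hij'
    rcases Nat.lt_or_gt_of_ne hij' with h | h
    · have h1 := hz.lt (2 * i) (2 * j) (by omega) (by omega)
      rw [hij] at h1
      exact h1.asymm h1
    · have h1 := hz.lt (2 * j) (2 * i) (by omega) (by omega)
      rw [hij] at h1
      exact h1.asymm h1
  obtain ⟨m, hm, hmin⟩ : ∃ m, y (m + 2) = y m ∧ ∀ j < m, y (j + 2) ≠ y j :=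
    ⟨Nat.find hex, Nat.find_spec hex, fun j hj => Nat.find_min hex hj⟩
  have hz : IsZigzag s f y (m + 1) := G.isZigzag hy fun j hj => hmin j (by omega)
  have hinj : ∀ i j, i < j → j ≤ m + 1 → y i ≠ y j := by
    intro i j hij hj h
    rcases (by omega : j = i + 1 ∨ i + 2 ≤ j) with rfl | h1
    · exact (hz.1 i hj).1 (by rw [h])
    · have h2 := hz.lt i j h1 hj
      rw [h] at h2
      exact h2.asymm h2
  have hinj' : ∀ i j, i ≤ m + 1 → j ≤ m + 1 → y i = y j → i = j := by
    intro i j hi hj h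
    rcases lt_trichotomy i j with h1 | h1 | h1
    · exact absurd h (hinj i j h1 hj)
    · exact h1
    · exact absurd h.symm (hinj j i h1 hi)
  obtain ⟨r, hr, hr0⟩ : ∃ r : α → ℕ, (∀ j, 3 ≤ j → j ≤ m + 1 → r (y j) = j - 2) ∧
      ∀ x, (∀ j, 3 ≤ j → j ≤ m + 1 → y j ≠ x) → r x = 0 := by
    refine ⟨fun x => if h : ∃ j, 3 ≤ j ∧ j ≤ m + 1 ∧ y j = x then h.choose - 2 else 0,
      fun j hj hj' => ?_, fun x hx => ?_⟩
    · have h : ∃ i, 3 ≤ i ∧ i ≤ m + 1 ∧ y i = y j := ⟨j, hj, hj', rfl⟩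
      simp only [h, dite_true]
      rw [hinj' _ _ h.choose_spec.2.1 hj' h.choose_spec.2.2]
    · refine dif_neg ?_
      rintro ⟨j, h1, h2, h3⟩
      exact hx j h1 h2 h3
  have hr1 : ∀ x, 1 ≤ r x → r x + 2 ≤ m + 1 ∧ y (r x + 2) = x := by
    intro x hx
    by_contra h
    have h1 : r x = 0 := hr0 x fun j h1 h2 h3 => h (by
      rw [← h3, hr j h1 h2, show j - 2 + 2 = j by omega]
      exact ⟨h2, rfl⟩)
    omega
  have off : ∀ x, r x = 0 → ∀ j, 3 ≤ j → j ≤ m + 1 → y j ≠ x := by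
    rintro x hx j h1 h2 rfl
    rw [hr j h1 h2] at hx
    omega
  have hstep : ∀ j, f (y j) ≤ f v + j := fun j => G.iterate_le v j
  have offle : ∀ x, r x = 0 → ∀ j, 4 ≤ j → j ≤ m + 1 → RLt s f x (y j) := by
    intro x hx j h1 h2
    have h3 := G.le_of_not_claw hv hy hz rfl hm (off x hx) (m - 1) (by omega)
    rw [show m - (m - 1) = 1 by omega] at h3
    have h4 := hz.lt 1 j (by omega) h2
    have h5 := hz.lt 2 j (by omega) h2
    have h6 := hz.1 1 (by omega)
    have hs : ∀ x, s x = true ∨ s x = false := fun x => by cases s x <;> simp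
    clear hy hz hm hinj hinj' hr hr0 hr1 off hmin hex hstep
    simp only [Nat.reduceAdd] at *
    unfold RLt RInc at *
    grind
  refine ⟨r, fun x x' h1 h2 => ?_, fun x hx => ?_, fun x hx => ?_, fun x x' h => ?_,
    fun x i hx => ?_⟩
  · rw [← (hr1 x h2).2, ← (hr1 x' (h1 ▸ h2)).2, h1]
  · have h1 := hz.lt 0 (r x + 2) (by omega) (hr1 x hx).1
    rw [(hr1 x hx).2] at h1
    change RLt s f v x at h1
    rcases h1 with h3 | h3 <;> linarith [h3.2]
  · rcases (by omega : r x = 1 ∨ r x = 0) with h | h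
    · have h1 := (hr1 x (by omega)).2
      have h2 := hstep (r x + 2)
      rw [h1, h] at h2
      norm_num at h2
      linarith
    · rcases Nat.eq_zero_or_pos m with rfl | hm0
      · have h1 := G.stall (y 0) (by rw [← hy, ← hy]; exact hm) x
        have h2 := hstep 0
        have h3 := hstep 1
        rw [← hy] at h1
        push_cast at h2 h3
        by_cases h4 : s x = s (y 0)
        · linarith [h1.1 h4]
        · linarith [h1.2 h4]
      · have h1 := G.le_of_not_claw hv hy hz rfl hm (off x h) (m - 1) (by omega)
        rw [show m - (m - 1) = 1 by omega] at h1
        have h2 := hstep 1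
        have h3 := hstep 2
        push_cast at h2 h3
        by_cases h4 : s x = s (y 1)
        · linarith [h1.1 h4]
        · linarith [h1.2 h4]
  · rcases Nat.eq_zero_or_pos (r x) with h1 | h1 <;> rcases Nat.eq_zero_or_pos (r x') with h2 | h2
    · omega
    · have h3 := offle x h1 (r x' + 2) (by omega) (hr1 x' h2).1
      rw [(hr1 x' h2).2] at h3
      exact iff_of_true h3 (by omega)
    · have h3 := offle x' h2 (r x + 2) (by omega) (hr1 x h1).1
      rw [(hr1 x h1).2] at h3
      exact iff_of_false h3.asymm (by omega)
    · have h3 := hz.lt_iff (r x + 2) (r x' + 2) (hr1 x h1).1 (hr1 x' h2).1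
      rw [(hr1 x h1).2, (hr1 x' h2).2] at h3
      rw [h3]
      omega
  · have h1 := (hr1 x (by omega)).1
    exact ⟨y (i + 3), by rw [hr _ (by omega) (by omega)]; omega⟩

theorem IsMaxInc.greedy {α : Type*} [PartialOrder α] (h : SumIndec α) {s : α → Bool}
    (hs : ∀ x y, s x = s y → x ≤ y ∨ y ≤ x) {R : α → α} (hR : IsMaxInc s R) {f : α → ℚ}
    (hf : ∀ x y, x < y ↔ RLt s f x y) : Greedy s f R := by
  have hmono : ∀ x y, s x = s y → x ≤ y → f x ≤ f y := by
    intro x y h1 h2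
    rcases h2.eq_or_lt with rfl | h2
    · exact le_rfl
    · rcases (hf x y).1 h2 with h3 | h3
      · exact h3.2.le
      · exact absurd h1 h3.1
  refine ⟨fun x y h1 h2 => ?_, fun x => ?_, fun x z hz => ?_, fun x hx z => ?_⟩
  · by_contra hne
    rcases hs x y h1 with h3 | h3
    · rcases (hf x y).1 (lt_of_le_of_ne h3 hne) with h4 | h4
      · exact h4.2.ne h2
      · exact h4.1 h1
    · rcases (hf y x).1 (lt_of_le_of_ne h3 (Ne.symm hne)) with h4 | h4
      · exact h4.2.ne h2.symm
      · exact h4.1 h1.symm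
  · obtain ⟨h1, h2, h3, -⟩ := hR x
    refine ⟨h1.symm, ?_, ?_⟩
    · by_contra! h4
      exact h3 ((hf _ _).2 (Or.inr ⟨h1, h4⟩)).le
    · by_contra! h4
      exact h2 ((hf _ _).2 (Or.inr ⟨h1.symm, h4⟩)).le
  · obtain ⟨h1, -, -, h4⟩ := hR x
    have hne : x ≠ z := fun h => hz.1 (by rw [h])
    refine hmono _ _ ?_ (h4 z (fun h => ?_) fun h => ?_)
    · have := hz.1
      revert h1 this
      cases s x <;> cases s (R x) <;> cases s z <;> simp
    · exact hz.not_rlt ((hf _ _).1 (lt_of_le_of_ne h hne))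
    · exact hz.symm.not_rlt ((hf _ _).1 (lt_of_le_of_ne h hne.symm))
  · have h1 := hR.stall h hs hx z
    refine ⟨fun h2 => hmono _ _ h2 (h1.1 h2), fun h2 => hmono _ _ ?_ (h1.2 h2)⟩
    have h3 := (hR x).1
    revert h2 h3
    cases s x <;> cases s (R x) <;> cases s z <;> simp

theorem rlt_neg {α : Type*} {s : α → Bool} {f : α → ℚ} {x y : α} :
    RLt s (-f) x y ↔ RLt s f y x := by
  simp only [RLt, Pi.neg_apply, neg_lt_neg_iff, eq_comm (a := s x), ne_comm (a := s x)]
  refine or_congr Iff.rfl (and_congr Iff.rfl ?_)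
  constructor <;> intro h <;> linarith

theorem rinc_neg {α : Type*} {s : α → Bool} {f : α → ℚ} {x y : α} :
    RInc s (-f) x y ↔ RInc s f x y := by
  simp only [RInc, Pi.neg_apply]
  refine and_congr Iff.rfl ⟨fun h => ⟨?_, ?_⟩, fun h => ⟨?_, ?_⟩⟩ <;> linarith [h.1, h.2]

theorem Claw.of_neg {α : Type*} {s : α → Bool} {f : α → ℚ} {x : α} (h : Claw s (-f) x) :
    Claw s f x := by
  obtain ⟨a, b, c, ha, hb, hc, hab, hbc⟩ := h
  exact ⟨c, b, a, rinc_neg.1 hc, rinc_neg.1 hb, rinc_neg.1 ha, neg_lt_neg_iff.1 hbc,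
    neg_lt_neg_iff.1 hab⟩

/-- The comparison rule for elements of bounded level. -/
def LevLt (a b : ℤ) (p : Prop) : Prop :=
  (a % 2 = b % 2 ∧ (a < b ∨ (a = b ∧ p))) ∨ (a % 2 ≠ b % 2 ∧ (a + 3 ≤ b ∨ (b = a + 1 ∧ p)))

theorem rlt_iff_levLt {α : Type*} {s : α → Bool} {lev : α → ℤ} {r : α → ℚ}
    (hr : ∀ x, |r x| < 1 / 2) (hs : ∀ x y, s x = s y ↔ lev x % 2 = lev y % 2) (x y : α) :
    RLt s (fun z => lev z + r z) x y ↔ LevLt (lev x) (lev y) (r x < r y) := by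
  have hx := abs_lt.1 (hr x)
  have hy := abs_lt.1 (hr y)
  have hcast : ∀ a b : ℤ, a ≤ b → (a : ℚ) ≤ b := fun a b h => by exact_mod_cast h
  unfold RLt LevLt
  rw [ne_eq, ne_eq, hs x y]
  refine or_congr (and_congr_right fun h => ?_) (and_congr_right fun h => ?_)
  · rcases lt_trichotomy (lev x) (lev y) with h1 | h1 | h1
    · have h2 := hcast _ _ (show lev x + 1 ≤ lev y by omega)
      push_cast at h2
      exact iff_of_true (by linarith) (Or.inl h1)
    · simp [h1]
    · have h2 := hcast _ _ (show lev y + 1 ≤ lev x by omega)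
      push_cast at h2
      refine iff_of_false (by linarith) (by omega)
  · rcases (by omega : lev x + 3 ≤ lev y ∨ lev y = lev x + 1 ∨ lev y + 1 ≤ lev x) with
      h1 | h1 | h1
    · have h2 := hcast _ _ h1
      push_cast at h2
      exact iff_of_true (by linarith) (Or.inl h1)
    · have h2 : (lev y : ℚ) = lev x + 1 := by exact_mod_cast h1
      constructor
      · intro h3
        exact Or.inr ⟨h1, by linarith⟩
      · rintro (h3 | h3)
        · omega
        · linarith [h3.2]
    · have h2 := hcast _ _ h1
      push_cast at h2
      refine iff_of_false (by linarith) (by omega)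

/-- Two paths `l` (downwards) and `r` (upwards), and elements of level in `[-B, B]` in between. -/
structure Layout {α : Type*} [PartialOrder α] (B : ℕ) (l r : α → ℕ) (lev : α → ℤ)
    (ρ : α → ℚ) : Prop where
  l_inj : ∀ x y, l x = l y → 1 ≤ l x → x = y
  r_inj : ∀ x y, r x = r y → 1 ≤ r x → x = y
  l_pred : ∀ x i, l x = i + 2 → ∃ y, l y = i + 1
  r_pred : ∀ x i, r x = i + 2 → ∃ y, r y = i + 1
  l_lt : ∀ x y, 2 ≤ l x ∨ 2 ≤ l y → (x < y ↔ l y + 2 ≤ l x)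
  r_lt : ∀ x y, 2 ≤ r x ∨ 2 ≤ r y → (x < y ↔ r x + 2 ≤ r y)
  bound : ∀ x, l x ≤ 1 → r x ≤ 1 → -B ≤ lev x ∧ lev x ≤ B
  disj : ∀ x, l x = 0 ∨ r x = 0
  ne : ∀ x y, x ≠ y → (lev x = lev y ∨ lev y = lev x + 1) → ρ x ≠ ρ y
  lt : ∀ x y, x < y ↔ LevLt (lev x) (lev y) (ρ x < ρ y)

theorem levLt_sub (a b c : ℤ) (p : Prop) : LevLt (a - c) (b - c) p ↔ LevLt a b p := by
  unfold LevLt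
  have h1 : (a - c) % 2 = (b - c) % 2 ↔ a % 2 = b % 2 := by omega
  rw [ne_eq, ne_eq, h1]
  refine or_congr (and_congr_right fun _ => ?_) (and_congr_right fun _ => ?_)
  · exact or_congr (by omega) (and_congr (by omega) Iff.rfl)
  · exact or_congr (by omega) (and_congr (by omega) Iff.rfl)

theorem exists_layout {α : Type*} [PartialOrder α] [Finite α] [Nontrivial α] (h : SumIndec α)
    (s : α → Bool) (hs : ∀ x y, s x = s y → x ≤ y ∨ y ≤ x) (k : ℕ)
    (hk : ∀ f : α → ℚ, (∀ x y, x < y ↔ RLt s f x y) → ∀ n, k ≤ n → ∀ q, ¬ IsForked s f q n) :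
    ∃ (l r : α → ℕ) (lev : α → ℤ) (ρ : α → ℚ), Layout (k + 16) l r lev ρ := by
  obtain ⟨lev, ρ, h1, h2, h3, h4⟩ := exists_rep h s hs
  obtain ⟨f, hf⟩ : ∃ f : α → ℚ, f = fun z => lev z + ρ z := ⟨_, rfl⟩
  have h5 : ∀ x y, x < y ↔ LevLt (lev x) (lev y) (ρ x < ρ y) :=
    fun x y => (h4 x y).trans (rlt_iff_levLt h1 h2 x y)
  rw [← hf] at h4
  obtain ⟨R, hR⟩ := exists_isMaxInc h s hs
  have hgr : Greedy s f R := hR.greedy h hs h4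
  have hs' : ∀ x y : αᵒᵈ, s x = s y → x ≤ y ∨ y ≤ x := fun x y hxy => (hs x y hxy).symm
  obtain ⟨L, hL⟩ := exists_isMaxInc (α := αᵒᵈ) h.dual s hs'
  have hgl : Greedy (α := α) s (-f) L := hL.greedy (α := αᵒᵈ) (f := -f) h.dual hs'
    fun x y => (h4 y x).trans rlt_neg.symm
  obtain ⟨u, v, hu, hv, huv, huv'⟩ : ∃ u v, (∀ x, f x < f u → ¬ Claw s f x) ∧
      (∀ x, f v < f x → ¬ Claw s f x) ∧ f v ≤ f u + k + 10 ∧ f u ≤ f v := by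
    by_cases hex : ∃ x, Claw s f x
    · obtain ⟨u, hu, humin⟩ := Set.exists_min_image {x | Claw s f x} f (Set.toFinite _) hex
      obtain ⟨v, hv, hvmax⟩ := Set.exists_max_image {x | Claw s f x} f (Set.toFinite _) hex
      refine ⟨u, v, fun x hx hc => (humin x hc).not_gt hx, fun x hx hc => (hvmax x hc).not_gt hx,
        ?_, humin v hv⟩
      by_contra! hlt
      obtain ⟨n, hn, q, hq⟩ := hgr.exists_forked hu hv hlt
      exact hk f h4 n hn q hq
    · push Not at hex
      obtain ⟨u⟩ : Nonempty α := inferInstance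
      exact ⟨u, u, fun x _ => hex x, fun x _ => hex x, by
        have : (0 : ℚ) ≤ k := Nat.cast_nonneg k
        linarith, le_rfl⟩
  obtain ⟨r, r1, r2, r3, r4, r5⟩ := hgr.exists_path hv
  obtain ⟨l, l1, l2, l3, l4, l5⟩ := hgl.exists_path (v := u)
    fun x hx hc => hu x (neg_lt_neg_iff.1 hx) hc.of_neg
  refine ⟨l, r, fun x => lev x - lev u, ρ, l1, r1, l5, r5, fun x y hxy => ?_, fun x y hxy => ?_,
    fun x hl hr => ?_, fun x => ?_,
    fun x y hxy hlev => h3 x y hxy (by omega), fun x y => ?_⟩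
  · rw [h4, ← rlt_neg, l4 y x hxy.symm]
  · rw [h4, r4 x y hxy]
  · have a1 := l3 x hl
    have a2 := r3 x hr
    simp only [Pi.neg_apply, hf] at a1 a2 huv
    have b1 := abs_lt.1 (h1 x)
    have b2 := abs_lt.1 (h1 u)
    have b3 := abs_lt.1 (h1 v)
    have c1 : (lev u : ℚ) ≤ lev x + 5 := by linarith
    have c2 : (lev x : ℚ) ≤ lev u + k + 16 := by linarith
    have c1' : lev u ≤ lev x + 5 := by exact_mod_cast c1
    have c2' : lev x ≤ lev u + k + 16 := by exact_mod_cast c2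
    push_cast
    omega
  · by_contra! hx
    have a1 := l2 x (by omega)
    have a2 := r2 x (by omega)
    simp only [Pi.neg_apply] at a1
    linarith
  · rw [levLt_sub, h5]

/-- The letter recording an element of a layout. -/
def layoutLetter {α : Type*} (l r : α → ℕ) (lev : α → ℤ) (x : α) : ℤ × ℕ × ℕ :=
  if l x ≤ 1 ∧ r x ≤ 1 then (lev x, l x, r x) else (0, min (l x) 2, min (r x) 2)

theorem layoutLetter_eq {α β : Type*} {l r : α → ℕ} {lev : α → ℤ} {l' r' : β → ℕ}
    {lev' : β → ℤ} {x : α} {y : β} (h : layoutLetter l r lev x = layoutLetter l' r' lev' y)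
    (hl : l x ≤ 1) (hr : r x ≤ 1) : lev' y = lev x ∧ l' y = l x ∧ r' y = r x := by
  unfold layoutLetter at h
  rw [if_pos ⟨hl, hr⟩] at h
  split_ifs at h with h1
  · simp only [Prod.mk.injEq] at h
    exact ⟨h.1.symm, h.2.1.symm, h.2.2.symm⟩
  · simp only [Prod.mk.injEq] at h
    omega

theorem levLt_congr {a b : ℤ} {p q : Prop} (h : a = b ∨ b = a + 1 → (p ↔ q)) :
    LevLt a b p ↔ LevLt a b q := by
  unfold LevLt
  refine or_congr (and_congr_right fun _ => or_congr_right (and_congr_right fun h1 => ?_))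
    (and_congr_right fun _ => or_congr_right (and_congr_right fun h1 => ?_))
  · exact h (Or.inl h1)
  · exact h (Or.inr h1)

theorem lt_iff_pos_lt {α : Type*} {n : ℕ} {ρ : α → ℚ} {e : Fin n ≃ α}
    (he : ∀ i j, i.1 ≤ j.1 → ρ (e i) ≤ ρ (e j)) {x y : α} (hne : ρ x ≠ ρ y) :
    ρ x < ρ y ↔ (e.symm x).1 < (e.symm y).1 := by
  have h1 := he (e.symm x) (e.symm y)
  have h2 := he (e.symm y) (e.symm x)
  rw [e.apply_symm_apply, e.apply_symm_apply] at h1 h2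
  constructor
  · intro h
    by_contra! h3
    exact (h2 h3).not_gt h
  · intro h
    exact lt_of_le_of_ne (h1 h.le) hne

theorem Layout.exists_embedding {α β : Type*} [PartialOrder α] [PartialOrder β] {B B' : ℕ}
    {l r : α → ℕ} {lev : α → ℤ} {ρ : α → ℚ} {l' r' : β → ℕ} {lev' : β → ℤ} {ρ' : β → ℚ}
    (A : Layout B l r lev ρ) (A' : Layout B' l' r' lev' ρ') {n n' : ℕ} {e : Fin n ≃ α}
    {e' : Fin n' ≃ β} (he : ∀ i j, i.1 ≤ j.1 → ρ (e i) ≤ ρ (e j))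
    (he' : ∀ i j, i.1 ≤ j.1 → ρ' (e' i) ≤ ρ' (e' j))
    (hl : ∀ x, 1 ≤ l x → ∃ y, l' y = l x) (hr : ∀ x, 1 ≤ r x → ∃ y, r' y = r x)
    (hw : (List.ofFn fun i => layoutLetter l r lev (e i)).Sublist
      (List.ofFn fun i => layoutLetter l' r' lev' (e' i))) :
    ∃ g : α → β, Function.Injective g ∧ ∀ x y, x ≤ y ↔ g x ≤ g y := by
  classical
  obtain ⟨φ, hφ⟩ := List.sublist_iff_exists_orderEmbedding_getElem?_eq.1 hw
  have hφ' : ∀ i : Fin n, ∃ h : φ i < n',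
      layoutLetter l r lev (e i) = layoutLetter l' r' lev' (e' ⟨φ i, h⟩) := by
    intro i
    have h1 := hφ i
    rw [List.getElem?_ofFn, dif_pos i.2, List.getElem?_ofFn] at h1
    split_ifs at h1 with h2
    exact ⟨h2, Option.some.inj h1⟩
  choose hlt hletter using hφ'
  have key : ∀ x, ∃ y, l' y = l x ∧ r' y = r x ∧ (l x ≤ 1 → r x ≤ 1 →
      lev' y = lev x ∧ (e'.symm y).1 = φ (e.symm x)) := by
    intro x
    by_cases h1 : 2 ≤ l x
    · obtain ⟨y, hy⟩ := hl x (by omega)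
      refine ⟨y, hy, ?_, fun h => by omega⟩
      have := A.disj x
      have := A'.disj y
      omega
    · by_cases h2 : 2 ≤ r x
      · obtain ⟨y, hy⟩ := hr x (by omega)
        refine ⟨y, ?_, hy, fun _ h => by omega⟩
        have := A.disj x
        have := A'.disj y
        omega
      · have h3 := hletter (e.symm x)
        rw [e.apply_symm_apply] at h3
        obtain ⟨h4, h5, h6⟩ := layoutLetter_eq h3 (by omega) (by omega)
        exact ⟨_, h5, h6, fun _ _ => ⟨h4, by rw [Equiv.symm_apply_apply]⟩⟩
  choose g gl gr gφ using key
  have ginj : Function.Injective g := by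
    intro x y hxy
    have h1 := gl x
    have h2 := gr x
    rw [hxy, gl y] at h1
    rw [hxy, gr y] at h2
    by_cases h3 : 1 ≤ l x
    · exact A.l_inj x y h1.symm h3
    · by_cases h4 : 1 ≤ r x
      · exact A.r_inj x y h2.symm h4
      · have h5 := (gφ x (by omega) (by omega)).2
        rw [hxy, (gφ y (by omega) (by omega)).2] at h5
        exact e.symm.injective (Fin.ext (φ.injective h5.symm))
  have glt : ∀ x y, x < y ↔ g x < g y := by
    intro x y
    by_cases h1 : 2 ≤ l x ∨ 2 ≤ l y
    · rw [A.l_lt x y h1, A'.l_lt (g x) (g y) (by rwa [gl, gl]), gl, gl]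
    · by_cases h2 : 2 ≤ r x ∨ 2 ≤ r y
      · rw [A.r_lt x y h2, A'.r_lt (g x) (g y) (by rwa [gr, gr]), gr, gr]
      · by_cases hxy : x = y
        · simp [hxy]
        · obtain ⟨hx1, hx2⟩ := gφ x (by omega) (by omega)
          obtain ⟨hy1, hy2⟩ := gφ y (by omega) (by omega)
          rw [A.lt, A'.lt, hx1, hy1]
          refine levLt_congr fun h3 => ?_
          have h4 := A.ne x y hxy h3
          have h5 := A'.ne (g x) (g y) (fun h => hxy (ginj h)) (by rwa [hx1, hy1])
          rw [lt_iff_pos_lt he h4, lt_iff_pos_lt he' h5, hx2, hy2, φ.lt_iff_lt]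
  refine ⟨g, ginj, fun x y => ?_⟩
  rw [le_iff_lt_or_eq, le_iff_lt_or_eq, glt, ginj.eq_iff]

/-- The pair `c` and the word `w` describe `P` up to embeddings. -/
def HasCode (B : ℕ) (P : FinPoset) (c : ℕ × ℕ) (w : List (ℤ × ℕ × ℕ)) : Prop :=
  ∃ (l r : Fin P.1 → ℕ) (lev : Fin P.1 → ℤ) (ρ : Fin P.1 → ℚ) (e : Fin P.1 ≃ Fin P.1),
    @Layout _ P.2 B l r lev ρ ∧ (∀ i j, i.1 ≤ j.1 → ρ (e i) ≤ ρ (e j)) ∧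
    (∀ i, 1 ≤ i → (i ≤ c.1 ↔ ∃ x, l x = i)) ∧ (∀ i, 1 ≤ i → (i ≤ c.2 ↔ ∃ x, r x = i)) ∧
    w = List.ofFn fun i => layoutLetter l r lev (e i)

theorem HasCode.pemb {B B' : ℕ} {P Q : FinPoset} {c d : ℕ × ℕ} {w w' : List (ℤ × ℕ × ℕ)}
    (h : HasCode B P c w) (h' : HasCode B' Q d w') (hcd : c ≤ d) (hw : w.Sublist w') :
    PEmb P Q := by
  obtain ⟨l, r, lev, ρ, e, A, he, hl, hr, rfl⟩ := h
  obtain ⟨l', r', lev', ρ', e', A', he', hl', hr', rfl⟩ := h'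
  exact @Layout.exists_embedding _ _ P.2 Q.2 _ _ _ _ _ _ _ _ _ _ A A' _ _ e e' he he'
    (fun x hx => (hl' _ hx).1 (((hl _ hx).2 ⟨x, rfl⟩).trans hcd.1))
    (fun x hx => (hr' _ hx).1 (((hr _ hx).2 ⟨x, rfl⟩).trans hcd.2)) hw

theorem exists_max_value {α : Type*} [Finite α] (l : α → ℕ)
    (hl : ∀ x i, l x = i + 2 → ∃ y, l y = i + 1) :
    ∃ a, ∀ i, 1 ≤ i → (i ≤ a ↔ ∃ x, l x = i) := by
  cases isEmpty_or_nonempty α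
  · exact ⟨0, fun i hi => iff_of_false (by omega) (by simp)⟩
  · obtain ⟨x, hx⟩ := Finite.exists_max l
    have key : ∀ d i, 1 ≤ i → i + d = l x → ∃ y, l y = i := by
      intro d
      induction d with
      | zero => exact fun i _ h => ⟨x, h.symm⟩
      | succ d ih =>
        intro i hi h
        obtain ⟨y, hy⟩ := ih (i + 1) (by omega) (by omega)
        obtain ⟨j, rfl⟩ : ∃ j, i = j + 1 := ⟨i - 1, by omega⟩
        exact hl y j hy
    refine ⟨l x, fun i hi => ⟨fun h => key (l x - i) i hi (by omega), ?_⟩⟩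
    rintro ⟨y, rfl⟩
    exact hx y

/-- The letters of bounded level. -/
def letterSet (B : ℕ) : Set (ℤ × ℕ × ℕ) := Set.Icc (-B : ℤ) B ×ˢ (Set.Iic 2 ×ˢ Set.Iic 2)

theorem Layout.hasCode {B : ℕ} {P : FinPoset} {l r : Fin P.1 → ℕ} {lev : Fin P.1 → ℤ}
    {ρ : Fin P.1 → ℚ} (A : @Layout _ P.2 B l r lev ρ) :
    ∃ c w, HasCode B P c w ∧ w ∈ {w | ∀ x ∈ w, x ∈ letterSet B} := by
  obtain ⟨a, ha⟩ := exists_max_value l (@Layout.l_pred _ P.2 _ _ _ _ _ A)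
  obtain ⟨b, hb⟩ := exists_max_value r (@Layout.r_pred _ P.2 _ _ _ _ _ A)
  refine ⟨(a, b), _, ⟨l, r, lev, ρ, Tuple.sort ρ, A,
    fun i j hij => Tuple.monotone_sort ρ hij, ha, hb, rfl⟩, fun x hx => ?_⟩
  obtain ⟨i, rfl⟩ := (List.mem_ofFn' _ _).1 hx
  simp only [layoutLetter]
  split_ifs with h
  · have := @Layout.bound _ P.2 _ _ _ _ _ A _ h.1 h.2
    refine ⟨this, ?_, ?_⟩ <;> simp only [Set.mem_Iic] <;> omega
  · refine ⟨?_, ?_, ?_⟩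
    · simp
    · simp
    · simp

theorem exists_pemb_of_hasCode {B : ℕ} {P : ℕ → FinPoset} {c : ℕ → ℕ × ℕ}
    {w : ℕ → List (ℤ × ℕ × ℕ)} (h : ∀ i, HasCode B (P i) (c i) (w i))
    (hw : ∀ i, w i ∈ {w | ∀ x ∈ w, x ∈ letterSet B}) : ∃ i j, i < j ∧ PEmb (P i) (P j) := by
  have hfin : (letterSet B).PartiallyWellOrderedOn Eq :=
    ((Set.finite_Icc _ _).prod
      ((Set.finite_Iic _).prod (Set.finite_Iic _))).partiallyWellOrderedOn
  have : IsPreorder (List (ℤ × ℕ × ℕ)) (List.SublistForall₂ Eq) := {}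
  obtain ⟨g, hg⟩ := (hfin.partiallyWellOrderedOn_sublistForall₂ Eq).exists_monotone_subseq hw
  obtain ⟨m, n, hmn, hle⟩ := wellQuasiOrdered_le (c ∘ g)
  refine ⟨g m, g n, g.lt_iff_lt.2 hmn, (h _).pemb (h _) hle ?_⟩
  obtain ⟨v, hv, hv'⟩ := List.sublistForall₂_iff.1 (hg m n hmn.le)
  have hv2 : w (g m) = v := by
    have := hv
    rwa [show (List.Forall₂ Eq : List (ℤ × ℕ × ℕ) → _) = Eq from List.forall₂_eq_eq_eq] at this
  rw [hv2]
  exact hv'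

theorem PEmb.refl (P : FinPoset) : PEmb P P := ⟨id, Function.injective_id, fun _ _ => Iff.rfl⟩

theorem PEmb.trans {P Q R : FinPoset} (h : PEmb P Q) (h' : PEmb Q R) : PEmb P R := by
  obtain ⟨f, hf, hle⟩ := h
  obtain ⟨g, hg, hle'⟩ := h'
  exact ⟨g ∘ f, hg.comp hf, fun a b => (hle a b).trans (hle' _ _)⟩

instance : IsPreorder FinPoset PEmb where
  refl := PEmb.refl
  trans := fun _ _ _ => PEmb.trans

theorem pemb_of_card_eq_zero {P : FinPoset} (h : P.1 = 0) (Q : FinPoset) : PEmb P Q := by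
  have hP : IsEmpty (Fin P.1) := by
    rw [h]
    infer_instance
  exact ⟨fun a => isEmptyElim a, fun a => isEmptyElim a, fun a => isEmptyElim a⟩

theorem pemb_of_card_eq_one {P Q : FinPoset} (h : P.1 = 1) (hQ : 0 < Q.1) : PEmb P Q := by
  have hP : ∀ a b : Fin P.1, a = b := fun a b => Fin.ext (by omega)
  refine ⟨fun _ => ⟨0, hQ⟩, fun a b _ => hP a b, fun a b => ?_⟩
  rw [hP a b]
  exact iff_of_true (@le_refl _ P.2.toPreorder _) (@le_refl _ Q.2.toPreorder _)

/-- The finite posets of width at most two without forks of index at least `k`. -/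
def forkFree (k : ℕ) : Set FinPoset := {P | WidthLE2 P.2.le ∧ ∀ n, k ≤ n → ¬ PEmb (fork n) P}

theorem forkFree_hered (k : ℕ) : PHered (forkFree k) := by
  rintro P Q h ⟨h1, h2⟩
  refine ⟨?_, fun n hn hP => h2 n hn (hP.trans h)⟩
  obtain ⟨f, -, hle⟩ := h
  intro a b c
  have := h1 (f a) (f b) (f c)
  rwa [← hle, ← hle, ← hle, ← hle, ← hle, ← hle] at this

theorem exists_hasCode {k : ℕ} {P : FinPoset} (hP : P ∈ forkFree k) (hi : @SumIndec _ P.2)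
    (h2 : 2 ≤ P.1) : ∃ c w, HasCode (k + 16) P c w ∧
      w ∈ {w | ∀ x ∈ w, x ∈ letterSet (k + 16)} := by
  have hnt : Nontrivial (Fin P.1) := Fin.nontrivial_iff_two_le.2 h2
  obtain ⟨s, hs⟩ := @exists_chain_coloring _ P.2 _ Finset.univ rfl
    fun a _ b _ c _ => hP.1 a b c
  obtain ⟨l, r, lev, ρ, A⟩ := @exists_layout _ P.2 _ _ hi s
    (fun x y => hs x (Finset.mem_univ x) y (Finset.mem_univ y)) k
    fun f hf n hn q hq => hP.2 n hn (hq.pemb hf)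
  exact A.hasCode

theorem partiallyWellOrderedOn_sumIndec (k : ℕ) :
    {P | P ∈ forkFree k ∧ @SumIndec _ P.2}.PartiallyWellOrderedOn PEmb := by
  rw [Set.partiallyWellOrderedOn_iff_exists_lt]
  intro f hf
  by_cases h0 : ∃ i, (f i).1 = 0
  · obtain ⟨i, hi⟩ := h0
    exact ⟨i, i + 1, by omega, pemb_of_card_eq_zero hi _⟩
  · push Not at h0
    by_cases h1 : ∃ i, (f i).1 = 1
    · obtain ⟨i, hi⟩ := h1
      exact ⟨i, i + 1, by omega, pemb_of_card_eq_one hi (Nat.pos_of_ne_zero (h0 _))⟩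
    · push Not at h1
      have h2 : ∀ i, ∃ c w, HasCode (k + 16) (f i) c w ∧
          w ∈ {w | ∀ x ∈ w, x ∈ letterSet (k + 16)} := fun i =>
        exists_hasCode (hf i).1 (hf i).2 (by
          have := h0 i
          have := h1 i
          omega)
      choose c w hc hw using h2
      exact exists_pemb_of_hasCode hc hw

/-- `P` is the ordinal sum of `Q` and `R`. -/
def IsOrdSum (Q R P : FinPoset) : Prop :=
  ∃ e : Fin Q.1 ⊕ Fin R.1 ≃ Fin P.1,
    (∀ a b, P.2.le (e (Sum.inl a)) (e (Sum.inl b)) ↔ Q.2.le a b) ∧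
    (∀ a b, P.2.le (e (Sum.inr a)) (e (Sum.inr b)) ↔ R.2.le a b) ∧
    ∀ a b, P.2.le (e (Sum.inl a)) (e (Sum.inr b)) ∧ ¬ P.2.le (e (Sum.inr b)) (e (Sum.inl a))

theorem IsOrdSum.pemb_right {Q R P : FinPoset} (h : IsOrdSum Q R P) : PEmb R P := by
  obtain ⟨e, -, h2, -⟩ := h
  exact ⟨fun a => e (Sum.inr a), e.injective.comp Sum.inr_injective, fun a b => (h2 a b).symm⟩

theorem IsOrdSum.pemb {Q R P Q' R' P' : FinPoset} (h : IsOrdSum Q R P) (h' : IsOrdSum Q' R' P')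
    (hQ : PEmb Q Q') (hR : PEmb R R') : PEmb P P' := by
  obtain ⟨e, h1, h2, h3⟩ := h
  obtain ⟨e', h1', h2', h3'⟩ := h'
  obtain ⟨f, hf, hfle⟩ := hQ
  obtain ⟨g, hg, hgle⟩ := hR
  refine ⟨fun x => e' (Sum.map f g (e.symm x)),
    e'.injective.comp ((hf.sumMap hg).comp e.symm.injective), fun a b => ?_⟩
  obtain ⟨a, rfl⟩ := e.surjective a
  obtain ⟨b, rfl⟩ := e.surjective b
  simp only [e.symm_apply_apply]
  rcases a with a | a <;> rcases b with b | b <;> simp only [Sum.map_inl, Sum.map_inr]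
  · rw [h1, h1', hfle]
  · exact iff_of_true (h3 _ _).1 (h3' _ _).1
  · exact iff_of_false (h3 _ _).2 (h3' _ _).2
  · rw [h2, h2', hgle]

/-- `P` is the ordinal sum of the posets in the list. -/
inductive OrdDecomp : List FinPoset → FinPoset → Prop
  | nil {P : FinPoset} (h : P.1 = 0) : OrdDecomp [] P
  | cons {Q R P : FinPoset} {l : List FinPoset} (h : OrdDecomp l R) (h' : IsOrdSum Q R P) :
      OrdDecomp (Q :: l) P

theorem OrdDecomp.pemb {l l' : List FinPoset} (h : List.SublistForall₂ PEmb l l') :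
    ∀ {P P' : FinPoset}, OrdDecomp l P → OrdDecomp l' P' → PEmb P P' := by
  induction h with
  | nil =>
    rintro P P' ⟨h⟩ -
    exact pemb_of_card_eq_zero h _
  | cons h1 _ ih =>
    rintro P P' (_ | ⟨h2, h3⟩) (_ | ⟨h4, h5⟩)
    exact h3.pemb h5 h1 (ih h2 h4)
  | cons_right _ ih =>
    rintro P P' h1 (_ | ⟨h2, h3⟩)
    exact (ih h1 h2).trans h3.pemb_right

/-- The poset induced on a subset. -/
noncomputable def subPoset (P : FinPoset) (S : Set (Fin P.1)) : FinPoset :=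
  ⟨Nat.card S, @PartialOrder.lift _ _ P.2 (fun i => ((Finite.equivFin S).symm i : Fin P.1))
    (Subtype.val_injective.comp (Equiv.injective _))⟩

theorem subPoset_pemb (P : FinPoset) (S : Set (Fin P.1)) : PEmb (subPoset P S) P :=
  ⟨fun i => ((Finite.equivFin S).symm i : Fin P.1),
    Subtype.val_injective.comp (Equiv.injective _), fun _ _ => Iff.rfl⟩

theorem isOrdSum_subPoset {P : FinPoset} {S : Set (Fin P.1)}
    (hS : ∀ a ∈ S, ∀ b ∉ S, P.2.lt a b) :
    IsOrdSum (subPoset P S) (subPoset P Sᶜ) P := by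
  classical
  refine ⟨(Equiv.sumCongr (Finite.equivFin S).symm (Finite.equivFin ↥Sᶜ).symm).trans
    (Equiv.Set.sumCompl S), fun a b => Iff.rfl, fun a b => Iff.rfl, fun a b => ?_⟩
  have h := hS _ ((Finite.equivFin S).symm a).2 _ ((Finite.equivFin ↥Sᶜ).symm b).2
  exact (@lt_iff_le_not_ge _ P.2.toPreorder _ _).1 h

theorem exists_ordDecomp (n : ℕ) : ∀ P : FinPoset, P.1 = n →
    ∃ l, OrdDecomp l P ∧ ∀ Q ∈ l, PEmb Q P ∧ @SumIndec _ Q.2 := by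
  induction n using Nat.strong_induction_on with
  | _ n ih =>
    intro P hP
    rcases Nat.eq_zero_or_pos n with rfl | hn
    · exact ⟨[], .nil hP, by simp⟩
    have hne : Nonempty (Fin P.1) := ⟨⟨0, by omega⟩⟩
    obtain ⟨S, ⟨hS0, hS⟩, hmin⟩ := Set.exists_min_image
      {S : Set (Fin P.1) | S.Nonempty ∧ ∀ a ∈ S, ∀ b ∉ S, P.2.lt a b} Set.ncard
      (Set.toFinite _) ⟨Set.univ, Set.univ_nonempty, fun a _ b hb => absurd (Set.mem_univ b) hb⟩
    have hindec : @SumIndec _ (subPoset P S).2 := by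
      intro T hT hT'
      by_contra! hlt
      let φ : Fin (subPoset P S).1 → Fin P.1 := fun i => ((Finite.equivFin S).symm i : Fin P.1)
      have hφ : Function.Injective φ := Subtype.val_injective.comp (Equiv.injective _)
      have hφS : ∀ i, φ i ∈ S := fun i => ((Finite.equivFin S).symm i).2
      have hφs : ∀ x ∈ S, ∃ i, φ i = x := fun x hx =>
        ⟨Finite.equivFin S ⟨x, hx⟩,
          congrArg Subtype.val ((Finite.equivFin S).symm_apply_apply ⟨x, hx⟩)⟩
      have h1 : (φ '' T).Nonempty ∧ ∀ a ∈ φ '' T, ∀ b ∉ φ '' T, P.2.lt a b := by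
        refine ⟨hT.image φ, ?_⟩
        rintro _ ⟨i, hi, rfl⟩ b hb
        by_cases hbS : b ∈ S
        · obtain ⟨j, rfl⟩ := hφs b hbS
          have h2 := hlt i hi j fun hj => hb ⟨j, hj, rfl⟩
          exact (@lt_iff_le_not_ge _ P.2.toPreorder _ _).2
            ((@lt_iff_le_not_ge _ (subPoset P S).2.toPreorder _ _).1 h2)
        · exact hS _ (hφS i) b hbS
      have h2 := hmin _ h1
      obtain ⟨j, hj⟩ := hT'
      have h3 : φ '' T ⊂ S := by
        refine ⟨fun x hx => ?_, fun h => ?_⟩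
        · obtain ⟨i, -, rfl⟩ := hx
          exact hφS i
        · obtain ⟨i, hi, hij⟩ := h (hφS j)
          exact hj (hφ hij ▸ hi)
      exact (Set.ncard_lt_ncard h3 (Set.toFinite _)).not_ge h2
    have hcard : (subPoset P Sᶜ).1 < n := by
      change Nat.card ↥Sᶜ < n
      rw [Nat.card_coe_set_eq]
      have h1 := Set.ncard_add_ncard_compl S
      rw [Nat.card_fin] at h1
      have h2 := (Set.ncard_pos (Set.toFinite S)).2 hS0
      omega
    obtain ⟨l, hl, hl'⟩ := ih _ hcard _ rfl
    refine ⟨_ :: l, .cons hl (isOrdSum_subPoset hS), ?_⟩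
    intro Q hQ
    rcases List.mem_cons.1 hQ with rfl | hQ
    · exact ⟨subPoset_pemb P S, hindec⟩
    · exact ⟨(hl' Q hQ).1.trans (subPoset_pemb P _), (hl' Q hQ).2⟩

theorem forkFree_pwqo (k : ℕ) : PWqo (forkFree k) := by
  intro f hf
  have h1 := fun i => exists_ordDecomp _ (f i) rfl
  choose l hl hl' using h1
  obtain ⟨i, j, hij, h⟩ := Set.partiallyWellOrderedOn_iff_exists_lt.1
    ((partiallyWellOrderedOn_sumIndec k).partiallyWellOrderedOn_sublistForall₂ PEmb) l
    fun i Q hQ => ⟨forkFree_hered k _ _ (hl' i Q hQ).1 (hf i), (hl' i Q hQ).2⟩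
  exact ⟨i, j, hij, OrdDecomp.pemb h (hl i) (hl j)⟩

theorem exists_subset_forkFree {C : Set FinPoset} (h1 : PHered C)
    (h2 : ∀ P ∈ C, WidthLE2 P.2.le) (h3 : PWqo C) : ∃ k, C ⊆ forkFree k := by
  by_contra! h
  have h4 : ∀ k, ∃ n, k < n ∧ fork n ∈ C := by
    intro k
    obtain ⟨P, hP, hP'⟩ := Set.not_subset.1 (h (k + 1))
    by_contra! h5
    exact hP' ⟨h2 P hP, fun n hn hn' => h5 n hn (h1 _ _ hn' hP)⟩
  obtain ⟨φ, hφ, hC⟩ := Nat.exists_strictMono_subsequence h4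
  obtain ⟨i, j, hij, hle⟩ := h3 (fun i => fork (φ i)) hC
  exact (le_of_pemb_fork hle).not_gt (hφ hij)

theorem exists_finset_obstructions {C W : Set FinPoset} (hC : PHered C) (hW : PWqo W)
    (hCW : C ⊆ W) : ∃ F : Finset FinPoset, C = {P | P ∈ W ∧ ∀ B ∈ F, ¬ PEmb B P} := by
  obtain ⟨F, hF, hF'⟩ : ∃ F : Finset FinPoset, (∀ B ∈ F, B ∈ W \ C) ∧
      ∀ P ∈ W \ C, ∃ B ∈ F, PEmb B P := by
    by_contra! h
    obtain ⟨f, hf, hf'⟩ := exists_seq_of_forall_finset_exists (fun P => P ∈ W \ C)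
      (fun P Q => ¬ PEmb P Q) h
    obtain ⟨i, j, hij, hle⟩ := hW f fun i => (hf i).1
    exact hf' i j hij hle
  refine ⟨F, Set.ext fun P => ⟨fun hP => ⟨hCW hP, fun B hB hle => (hF B hB).2 (hC _ _ hle hP)⟩,
    fun hP => ?_⟩⟩
  by_contra hPC
  obtain ⟨B, hB, hle⟩ := hF' P ⟨hP.1, hPC⟩
  exact hP.2 B hB hle

instance (n : ℕ) : Countable (PartialOrder (Fin n)) := by
  refine Function.Injective.countable (f := fun p : PartialOrder (Fin n) => p.le) fun p q h => ?_
  exact PartialOrder.ext fun a b => iff_of_eq (congrFun (congrFun h a) b)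

/-- There are only countably many wqo hereditary classes of finite posets of width at most
two. -/
theorem stmt_5 :
    Set.Countable {C : Set FinPoset |
      PHered C ∧ (∀ P ∈ C, WidthLE2 P.2.le) ∧ PWqo C} := by
  refine (Set.countable_range fun p : ℕ × Finset FinPoset =>
    {P | P ∈ forkFree p.1 ∧ ∀ B ∈ p.2, ¬ PEmb B P}).mono ?_
  rintro C ⟨h1, h2, h3⟩
  obtain ⟨k, hk⟩ := exists_subset_forkFree h1 h2 h3
  obtain ⟨F, hF⟩ := exists_finset_obstructions h1 (forkFree_pwqo k) hk
  exact ⟨(k, F), hF.symm⟩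
end

section
/- Let C be a hereditary class of finite simple graphs. The following are equivalent: (a) C contains an infinite antichain with respect to embeddability; (b) C contains uncountably many hereditary subclasses; (c) the collection of hereditary subclasses of C, ordered by set inclusion, is not well-founded; (d) there exists a collection of hereditary subclasses of C which, ordered by set inclusion, is order-isomorphic to the power set of ℕ ordered by set inclusion. -/
/-- A finite simple graph, encoded as a graph on `Fin n` for some `n`. -/
abbrev FinGraph := Σ n : ℕ, SimpleGraph (Fin n)

/-- Embeddability of finite graphs: `G` is isomorphic to an induced subgraph of `H`. -/
def GEmb (G H : FinGraph) : Prop := Nonempty (G.2 ↪g H.2)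

/-- A hereditary class of finite graphs. -/
def Hered (C : Set FinGraph) : Prop := ∀ G H : FinGraph, GEmb G H → H ∈ C → G ∈ C

/-- `C` contains an infinite antichain with respect to embeddability. -/
def HasInfiniteAntichain (C : Set FinGraph) : Prop :=
  ∃ f : ℕ → FinGraph, (∀ i, f i ∈ C) ∧ ∀ i j, i ≠ j → ¬ GEmb (f i) (f j)

theorem GEmb.refl (G : FinGraph) : GEmb G G := ⟨SimpleGraph.Embedding.refl⟩

theorem GEmb.trans {G H K : FinGraph} : GEmb G H → GEmb H K → GEmb G K :=
  fun ⟨f⟩ ⟨g⟩ => ⟨g.comp f⟩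

theorem GEmb.order_le {G H : FinGraph} : GEmb G H → G.1 ≤ H.1 := by
  rintro ⟨f⟩
  simpa using Fintype.card_le_of_injective f f.injective

theorem GEmb.symm_of_order_le {G H : FinGraph} (h : GEmb G H) (hle : H.1 ≤ G.1) : GEmb H G := by
  have heq : G.1 = H.1 := le_antisymm h.order_le hle
  obtain ⟨f⟩ := h
  have hb : Function.Bijective f :=
    (Fintype.bijective_iff_injective_and_card f).2 ⟨f.injective, by simpa using heq⟩
  exact ⟨(RelIso.ofSurjective f hb.2).symm.toRelEmbedding⟩

/-- If every antichain in `C` is finite, then every sequence in `C` has an increasing pair. -/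
theorem exists_lt_gEmb_of_not_hasInfiniteAntichain {C : Set FinGraph}
    (hC : ¬ HasInfiniteAntichain C) (f : ℕ → FinGraph) (hf : ∀ i, f i ∈ C) :
    ∃ i j, i < j ∧ GEmb (f i) (f j) := by
  by_contra! hbad
  have : IsTrans FinGraph (fun G H => GEmb H G) := ⟨fun _ _ _ h₁ h₂ => h₂.trans h₁⟩
  obtain ⟨g, hg⟩ := exists_increasing_or_nonincreasing_subseq (fun G H => GEmb H G) f
  rcases hg with hdesc | hanti
  · obtain ⟨i, j, hij, hle⟩ := wellQuasiOrdered_le (fun n => (f (g n)).1)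
    exact hbad _ _ (g.strictMono hij) ((hdesc i j hij).symm_of_order_le hle)
  · refine hC ⟨f ∘ g, fun i => hf _, fun i j hij => ?_⟩
    rcases hij.lt_or_gt with hlt | hlt
    · exact hbad _ _ (g.strictMono hlt)
    · exact hanti j i hlt

theorem wellFoundedOn_hereditary_of_not_hasInfiniteAntichain {C : Set FinGraph}
    (hC : ¬ HasInfiniteAntichain C) :
    {D : Set FinGraph | D ⊆ C ∧ Hered D}.WellFoundedOn (· ⊂ ·) := by
  rw [Set.wellFoundedOn_iff_no_descending_seq]
  intro F hF
  have hlt : ∀ i j, i < j → F j ⊂ F i := fun i j hij => F.map_rel_iff.2 hij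
  choose x hxF hx using fun i => Set.exists_of_ssubset (hlt i (i + 1) i.lt_succ_self)
  obtain ⟨i, j, hij, hemb⟩ := exists_lt_gEmb_of_not_hasInfiniteAntichain hC x
    fun i => (hF i).1 (hxF i)
  have hsub : F j ⊆ F (i + 1) := by
    rcases (Nat.succ_le_of_lt hij).eq_or_lt with h | h
    · exact (congrArg F h).ge
    · exact (hlt _ _ h).subset
  exact hx i ((hF (i + 1)).2 _ _ hemb (hsub (hxF j)))

/-- Under well-foundedness, each hereditary subclass is cut out of `C` by finitely many
forbidden graphs. -/
theorem exists_finset_forbidden {C : Set FinGraph} (hHered : Hered C)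
    (hwf : {D : Set FinGraph | D ⊆ C ∧ Hered D}.WellFoundedOn (· ⊂ ·))
    {D : Set FinGraph} (hDC : D ⊆ C) (hD : Hered D) :
    ∃ B : Finset FinGraph, {G ∈ C | ∀ b ∈ B, ¬ GEmb b G} = D := by
  classical
  let avoid (B : Finset FinGraph) : Set FinGraph := {G ∈ C | ∀ b ∈ B, ¬ GEmb b G}
  have hmem : ∀ B, avoid B ∈ {D : Set FinGraph | D ⊆ C ∧ Hered D} := fun B =>
    ⟨fun G hG => hG.1, fun G H hGH hH =>
      ⟨hHered G H hGH hH.1, fun b hb hbG => hH.2 b hb (hbG.trans hGH)⟩⟩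
  have hwf' : WellFounded fun B₁ B₂ => avoid B₁ ⊂ avoid B₂ :=
    Set.wellFoundedOn_range.1 (hwf.subset (Set.range_subset_iff.2 hmem))
  obtain ⟨B, hB, hmin⟩ := hwf'.has_min {B | ∀ b ∈ B, b ∉ D} ⟨∅, by simp⟩
  refine ⟨B, Set.Subset.antisymm (fun x hx => ?_) fun G hG =>
    ⟨hDC hG, fun b hb hbG => hB b hb (hD b G hbG hG)⟩⟩
  by_contra hxD
  refine hmin (insert x B) (fun b hb => ?_) ⟨fun G hG => ⟨hG.1, fun b hb =>
    hG.2 b (Finset.mem_insert_of_mem hb)⟩, fun h => (h hx).2 x (Finset.mem_insert_self x B)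
      (GEmb.refl x)⟩
  rcases Finset.mem_insert.1 hb with rfl | hb
  exacts [hxD, hB b hb]

theorem countable_hereditary_of_wellFoundedOn {C : Set FinGraph} (hHered : Hered C)
    (hwf : {D : Set FinGraph | D ⊆ C ∧ Hered D}.WellFoundedOn (· ⊂ ·)) :
    {D : Set FinGraph | D ⊆ C ∧ Hered D}.Countable :=
  (Set.countable_range fun B : Finset FinGraph => {G ∈ C | ∀ b ∈ B, ¬ GEmb b G}).mono
    fun _ hD => exists_finset_forbidden hHered hwf hD.1 hD.2

theorem HasInfiniteAntichain.exists_powerset_embedding {C : Set FinGraph} (hHered : Hered C)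
    (h : HasInfiniteAntichain C) :
    ∃ F : Set ℕ → Set FinGraph, (∀ s, F s ⊆ C ∧ Hered (F s)) ∧
      ∀ s t : Set ℕ, s ⊆ t ↔ F s ⊆ F t := by
  obtain ⟨f, hfC, hf⟩ := h
  refine ⟨fun s => {G | ∃ i ∈ s, GEmb G (f i)}, fun s => ⟨?_, ?_⟩, fun s t => ⟨?_, ?_⟩⟩
  · rintro G ⟨i, -, hG⟩
    exact hHered _ _ hG (hfC i)
  · rintro G H hGH ⟨i, hi, hH⟩
    exact ⟨i, hi, hGH.trans hH⟩
  · rintro hst G ⟨i, hi, hG⟩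
    exact ⟨i, hst hi, hG⟩
  · intro hst i hi
    obtain ⟨j, hj, hij⟩ := hst ⟨i, hi, GEmb.refl (f i)⟩
    by_cases h : i = j
    · exact h ▸ hj
    · exact absurd hij (hf i j h)

theorem not_countable_of_powerset_embedding {S : Set (Set FinGraph)}
    {F : Set ℕ → Set FinGraph} (hFS : ∀ s, F s ∈ S) (hF : ∀ s t : Set ℕ, s ⊆ t ↔ F s ⊆ F t) :
    ¬ S.Countable := by
  intro hS
  have hinj : Function.Injective F := fun s t h =>
    Set.Subset.antisymm ((hF s t).2 h.le) ((hF t s).2 h.ge)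
  have : Countable S := hS
  have : Countable (Set ℕ) :=
    Function.Injective.countable (f := fun s => (⟨F s, hFS s⟩ : S))
      fun s t h => hinj (congrArg Subtype.val h)
  obtain ⟨e, he⟩ := exists_injective_nat (Set ℕ)
  exact Function.cantor_injective e he

/-- For a hereditary class `C` of finite graphs, the following are equivalent:
(a) `C` contains an infinite antichain; (b) `C` has uncountably many hereditary subclasses;
(c) the hereditary subclasses of `C` are not well-founded under inclusion; (d) there is a
collection of hereditary subclasses of `C` order-isomorphic to the power set of `ℕ`. -/
theorem stmt_6 (C : Set FinGraph) (hHered : Hered C) :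
    (HasInfiniteAntichain C ↔
      ¬ Set.Countable {D : Set FinGraph | D ⊆ C ∧ Hered D}) ∧
    (HasInfiniteAntichain C ↔
      ¬ {D : Set FinGraph | D ⊆ C ∧ Hered D}.WellFoundedOn (· ⊂ ·)) ∧
    (HasInfiniteAntichain C ↔
      ∃ F : Set ℕ → Set FinGraph, (∀ s, F s ⊆ C ∧ Hered (F s)) ∧
        ∀ s t : Set ℕ, s ⊆ t ↔ F s ⊆ F t) := by
  have had := HasInfiniteAntichain.exists_powerset_embedding hHered
  have hdb : (∃ F : Set ℕ → Set FinGraph, (∀ s, F s ⊆ C ∧ Hered (F s)) ∧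
      ∀ s t : Set ℕ, s ⊆ t ↔ F s ⊆ F t) →
      ¬ Set.Countable {D : Set FinGraph | D ⊆ C ∧ Hered D} :=
    fun ⟨_, hFC, hF⟩ => not_countable_of_powerset_embedding hFC hF
  have hbc := mt (countable_hereditary_of_wellFoundedOn hHered)
  have hca := not_imp_comm.1 (wellFoundedOn_hereditary_of_not_hasInfiniteAntichain (C := C))
  exact ⟨⟨hdb ∘ had, hca ∘ hbc⟩, ⟨hbc ∘ hdb ∘ had, hca⟩, ⟨had, hca ∘ hbc ∘ hdb⟩⟩
end

section
/- Let G be a bipartite simple graph and let x, y be two vertices of G, each of degree at least 3, with graph distance d_G(x,y) = d ≥ 4. Then G contains an induced subgraph isomorphic to a double-ended fork DF_k for some k ≥ max(1, d − 4). -/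
/-- The graph `G` is bipartite: its vertex set splits into two independent sets. -/
def Bipartite {V : Type*} (G : SimpleGraph V) : Prop :=
  ∃ A : Set V, ∀ x y : V, G.Adj x y → (x ∈ A ↔ y ∉ A)

/-- The double-ended fork of length `n`: a path on vertices `0, …, n-1` together with four
extra vertices `n, n+1` adjacent to the end vertex `0` and `n+2, n+3` adjacent to the end
vertex `n-1`, the four extra vertices being pairwise nonadjacent. -/
def DF (n : ℕ) : SimpleGraph (Fin (n + 4)) :=
  SimpleGraph.fromRel (fun x y =>
    (x.val + 1 = y.val ∧ y.val < n) ∨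
    ((x.val = n ∨ x.val = n + 1) ∧ y.val = 0) ∨
    ((x.val = n + 2 ∨ x.val = n + 3) ∧ y.val = n - 1))

open SimpleGraph

theorem Bipartite.not_adj_of_adj_of_adj {V : Type*} {G : SimpleGraph V} (hG : Bipartite G)
    {u v w : V} (huv : G.Adj u v) (huw : G.Adj u w) : ¬ G.Adj v w := by
  obtain ⟨A, hA⟩ := hG
  intro hvw
  have h₁ := hA _ _ huv
  have h₂ := hA _ _ huw
  have h₃ := hA _ _ hvw
  tauto

/-- The distance from a fixed vertex grows by at most one along an edge, also when that vertex
lies in another component. -/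
theorem dist_le_dist_add_one_of_adj {V : Type*} (G : SimpleGraph V) (x : V) {u v : V}
    (huv : G.Adj u v) : G.dist x v ≤ G.dist x u + 1 := by
  by_cases hu : G.Reachable x u
  · obtain ⟨w, hw⟩ := hu.exists_walk_length_eq_dist
    have := dist_le (w.concat huv)
    rwa [Walk.length_concat, hw] at this
  · have hv : ¬ G.Reachable x v := fun h => hu (h.trans huv.symm.reachable)
    simp [dist_eq_zero_of_not_reachable hv]

/-- A sequence of consecutively adjacent vertices that realizes the distance between its ends
realizes all distances from its start. -/
theorem dist_eq_of_geodesic {V : Type*} {G : SimpleGraph V} {p : ℕ → V} {d : ℕ}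
    (hp : ∀ i < d, G.Adj (p i) (p (i + 1))) (hd : G.dist (p 0) (p d) = d) :
    ∀ i ≤ d, G.dist (p 0) (p i) = i := by
  have upper : ∀ i ≤ d, G.dist (p 0) (p i) ≤ i := by
    intro i
    induction i with
    | zero => simp
    | succ i ih =>
      intro hi
      have := dist_le_dist_add_one_of_adj G (p 0) (hp i (by omega))
      have := ih (by omega)
      omega
  have lower : ∀ j ≤ d, d ≤ G.dist (p 0) (p (d - j)) + j := by
    intro j
    induction j with
    | zero => simp [hd]
    | succ j ih =>
      intro hj
      have h₁ := dist_le_dist_add_one_of_adj G (p 0) (hp (d - (j + 1)) (by omega))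
      rw [show d - (j + 1) + 1 = d - j by omega] at h₁
      have := ih (by omega)
      omega
  intro i hi
  have h₁ := upper i hi
  have h₂ := lower (d - i) (by omega)
  rw [show d - (d - i) = i by omega] at h₂
  omega

/-- Near the start of a geodesic whose first vertex has degree at least `3`, one of the vertices
`p 0` and `p 2` carries two private leaves. -/
theorem exists_fork_of_geodesic {V : Type*} {G : SimpleGraph V} (hG : Bipartite G)
    {p : ℕ → V} {d : ℕ} (hd : 2 ≤ d)
    (hp : ∀ i < d, G.Adj (p i) (p (i + 1))) (hdist : G.dist (p 0) (p d) = d)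
    (hdeg : 3 ≤ (G.neighborSet (p 0)).ncard) :
    ∃ s ≤ 2, ∃ a b : V, a ≠ b ∧ G.Adj (p 0) a ∧ G.Adj (p 0) b ∧
      ∀ i, s ≤ i → i ≤ d →
        ((G.Adj a (p i) ↔ i = s) ∧ a ≠ p i) ∧ ((G.Adj b (p i) ↔ i = s) ∧ b ≠ p i) := by
  have hpi := dist_eq_of_geodesic hp hdist
  have h01 : G.Adj (p 0) (p 1) := hp 0 (by omega)
  have h12 : G.Adj (p 1) (p 2) := hp 1 (by omega)
  have near {a : V} (ha : G.Adj (p 0) a) : G.dist (p 0) a = 1 := dist_eq_one_iff_adj.2 ha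
  have adj_le {a : V} (ha : G.Adj (p 0) a) {i : ℕ} (hi : i ≤ d) (h : G.Adj a (p i)) :
      i ≤ 2 ∧ i ≠ 1 := by
    refine ⟨?_, ?_⟩
    · have := dist_le_dist_add_one_of_adj G (p 0) h
      rw [near ha, hpi i hi] at this
      omega
    · rintro rfl
      exact hG.not_adj_of_adj_of_adj ha h01 h
  have eq_one {a : V} (ha : G.Adj (p 0) a) {i : ℕ} (hi : i ≤ d) (h : a = p i) : i = 1 := by
    rw [← hpi i hi, ← h, near ha]
  have leaf_zero {a : V} (ha : G.Adj (p 0) a) (h1 : a ≠ p 1) (h2 : ¬ G.Adj a (p 2)) (i : ℕ)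
      (hi : i ≤ d) : (G.Adj a (p i) ↔ i = 0) ∧ a ≠ p i := by
    refine ⟨⟨fun h => ?_, ?_⟩, fun h => ?_⟩
    · have : i ≠ 2 := by rintro rfl; exact h2 h
      have := adj_le ha hi h
      omega
    · rintro rfl; exact ha.symm
    · obtain rfl := eq_one ha hi h
      exact h1 h
  have leaf_two {a : V} (ha : G.Adj (p 0) a) (h2 : G.Adj a (p 2)) (i : ℕ) (hs : 2 ≤ i)
      (hi : i ≤ d) : (G.Adj a (p i) ↔ i = 2) ∧ a ≠ p i := by
    refine ⟨⟨fun h => ?_, ?_⟩, fun h => ?_⟩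
    · have := adj_le ha hi h
      omega
    · rintro rfl; exact h2
    · have := eq_one ha hi h
      omega
  have hfin : (G.neighborSet (p 0)).Finite := Set.finite_of_ncard_pos (by omega)
  obtain ⟨a, b, ha, hb, hab⟩ : ∃ a b, a ∈ G.neighborSet (p 0) \ {p 1} ∧
      b ∈ G.neighborSet (p 0) \ {p 1} ∧ a ≠ b := by
    have hcard := Set.ncard_sdiff_singleton_add_one (s := G.neighborSet (p 0)) h01 hfin
    exact (Set.one_lt_ncard_iff hfin.sdiff).1 (by omega)
  obtain ⟨ha0, ha1⟩ := ha
  obtain ⟨hb0, hb1⟩ := hb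
  by_cases ha2 : G.Adj a (p 2)
  · exact ⟨2, le_rfl, a, p 1, ha1, ha0, h01, fun i hs hi =>
      ⟨leaf_two ha0 ha2 i hs hi, leaf_two h01 h12 i hs hi⟩⟩
  by_cases hb2 : G.Adj b (p 2)
  · exact ⟨2, le_rfl, b, p 1, hb1, hb0, h01, fun i hs hi =>
      ⟨leaf_two hb0 hb2 i hs hi, leaf_two h01 h12 i hs hi⟩⟩
  exact ⟨0, by omega, a, b, hab, ha0, hb0, fun i _ hi =>
    ⟨leaf_zero ha0 ha1 ha2 i hi, leaf_zero hb0 hb1 hb2 i hi⟩⟩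

/-- An induced path `q 0, …, q (k - 1)` with leaves `a`, `b` at its start and `c`, `e` at its end
is an induced double-ended fork. -/
theorem nonempty_DF_embedding {V : Type*} {G : SimpleGraph V} {k : ℕ} (hk : 1 ≤ k)
    {q : ℕ → V} {a b c e : V}
    (hqinj : ∀ i < k, ∀ j < k, q i = q j → i = j)
    (hq : ∀ i < k, ∀ j < k, (G.Adj (q i) (q j) ↔ i + 1 = j ∨ j + 1 = i))
    (ha : ∀ i < k, (G.Adj a (q i) ↔ i = 0) ∧ a ≠ q i)
    (hb : ∀ i < k, (G.Adj b (q i) ↔ i = 0) ∧ b ≠ q i)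
    (hc : ∀ i < k, (G.Adj c (q i) ↔ i = k - 1) ∧ c ≠ q i)
    (he : ∀ i < k, (G.Adj e (q i) ↔ i = k - 1) ∧ e ≠ q i)
    (hab : a ≠ b) (hce : c ≠ e) (hac : a ≠ c) (hae : a ≠ e) (hbc : b ≠ c) (hbe : b ≠ e)
    (nab : ¬ G.Adj a b) (nce : ¬ G.Adj c e) (nac : ¬ G.Adj a c) (nae : ¬ G.Adj a e)
    (nbc : ¬ G.Adj b c) (nbe : ¬ G.Adj b e) : Nonempty (DF k ↪g G) := by
  let f : Fin (k + 4) → V := fun v =>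
    if v.val < k then q v else if v.val = k then a else if v.val = k + 1 then b
    else if v.val = k + 2 then c else e
  have cases_val (v : Fin (k + 4)) : (v.val < k ∧ f v = q v) ∨ (v.val = k ∧ f v = a) ∨
      (v.val = k + 1 ∧ f v = b) ∨ (v.val = k + 2 ∧ f v = c) ∨ (v.val = k + 3 ∧ f v = e) := by
    have := v.isLt
    grind
  have hinj : Function.Injective f := by
    intro u v huv
    apply Fin.ext
    rcases cases_val u with ⟨hu, fu⟩ | ⟨hu, fu⟩ | ⟨hu, fu⟩ | ⟨hu, fu⟩ | ⟨hu, fu⟩ <;>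
    rcases cases_val v with ⟨hv, fv⟩ | ⟨hv, fv⟩ | ⟨hv, fv⟩ | ⟨hv, fv⟩ | ⟨hv, fv⟩ <;>
    rw [fu, fv] at huv <;> grind
  refine ⟨⟨⟨f, hinj⟩, ?_⟩⟩
  intro u v
  simp only [Function.Embedding.coeFn_mk, DF, fromRel_adj, ne_eq, Fin.ext_iff]
  rcases cases_val u with ⟨hu, fu⟩ | ⟨hu, fu⟩ | ⟨hu, fu⟩ | ⟨hu, fu⟩ | ⟨hu, fu⟩ <;>
  rcases cases_val v with ⟨hv, fv⟩ | ⟨hv, fv⟩ | ⟨hv, fv⟩ | ⟨hv, fv⟩ | ⟨hv, fv⟩ <;>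
  rw [fu, fv] <;> clear_value f <;>
  first
  | (rw [hq _ hu _ hv]; omega)
  | (rw [(ha _ hv).1]; omega)
  | (rw [(hb _ hv).1]; omega)
  | (rw [(hc _ hv).1]; omega)
  | (rw [(he _ hv).1]; omega)
  | (rw [G.adj_comm, (ha _ hu).1]; omega)
  | (rw [G.adj_comm, (hb _ hu).1]; omega)
  | (rw [G.adj_comm, (hc _ hu).1]; omega)
  | (rw [G.adj_comm, (he _ hu).1]; omega)
  | (refine iff_of_false ?_ (by omega)
     first | exact G.irrefl | assumption | (rw [G.adj_comm]; assumption))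

/-- If a bipartite graph has two vertices of degree at least `3` at distance `d ≥ 4`, then
it contains an induced double-ended fork of length at least `max 1 (d - 4)`. -/
theorem stmt_8 {V : Type*} (G : SimpleGraph V) (hbip : Bipartite G)
    (x y : V) (hx : 3 ≤ (G.neighborSet x).ncard) (hy : 3 ≤ (G.neighborSet y).ncard)
    (d : ℕ) (hreach : G.Reachable x y) (hdist : G.dist x y = d) (hd : 4 ≤ d) :
    ∃ k : ℕ, 1 ≤ k ∧ d - 4 ≤ k ∧ Nonempty (DF k ↪g G) := by
  obtain ⟨w, hw⟩ := hreach.exists_walk_length_eq_dist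
  rw [hdist] at hw
  obtain ⟨p, rfl, rfl, hp⟩ : ∃ p : ℕ → V, p 0 = x ∧ p d = y ∧
      ∀ i < d, G.Adj (p i) (p (i + 1)) :=
    ⟨w.getVert, w.getVert_zero, hw ▸ w.getVert_length,
      fun i hi => w.adj_getVert_succ (hw ▸ hi)⟩
  have hp' : ∀ i < d, G.Adj (p (d - i)) (p (d - (i + 1))) := by
    intro i hi
    have := (hp (d - (i + 1)) (by omega)).symm
    rwa [show d - (i + 1) + 1 = d - i by omega] at this
  obtain ⟨s, hs, a, b, hab, ha, hb, hleft⟩ :=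
    exists_fork_of_geodesic hbip (by omega) hp hdist hx
  obtain ⟨t, ht, c, e, hce, hc, he, hright⟩ :=
    exists_fork_of_geodesic (p := fun i => p (d - i)) hbip (by omega) hp'
      (by simpa [dist_comm] using hdist) (by simpa using hy)
  simp only [Nat.sub_zero] at hc he
  have hpi := dist_eq_of_geodesic hp hdist
  have far {u v : V} (hu : G.Adj (p 0) u) (hv : G.Adj (p d) v) : u ≠ v ∧ ¬ G.Adj u v := by
    have h₁ := dist_eq_one_iff_adj.2 hu
    have h₂ := dist_le_dist_add_one_of_adj G (p 0) hv.symm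
    refine ⟨?_, fun h => ?_⟩
    · rintro rfl
      omega
    · have := dist_le_dist_add_one_of_adj G (p 0) h
      omega
  have hl (i : ℕ) (hi : i < d - t - s + 1) := hleft (s + i) (by omega) (by omega)
  have hr (i : ℕ) (hi : i < d - t - s + 1) := by
    have := hright (d - (s + i)) (by omega) (by omega)
    rwa [show d - (d - (s + i)) = s + i by omega,
      show d - (s + i) = t ↔ i = d - t - s + 1 - 1 by omega] at this
  simp only [Nat.add_eq_left] at hl
  refine ⟨d - t - s + 1, by omega, by omega,
    nonempty_DF_embedding (by omega) (q := fun i => p (s + i)) ?_ ?_ (fun i hi => (hl i hi).1)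
      (fun i hi => (hl i hi).2) (fun i hi => (hr i hi).1) (fun i hi => (hr i hi).2) hab hce
      (far ha hc).1 (far ha he).1 (far hb hc).1 (far hb he).1
      (hbip.not_adj_of_adj_of_adj ha hb) (hbip.not_adj_of_adj_of_adj hc he)
      (far ha hc).2 (far ha he).2 (far hb hc).2 (far hb he).2⟩
  · intro i hi j hj h
    have h₁ := hpi (s + i) (by omega)
    have h₂ := hpi (s + j) (by omega)
    rw [h] at h₁
    omega
  · intro i hi j hj
    have h₁ := hpi (s + i) (by omega)
    have h₂ := hpi (s + j) (by omega)
    refine ⟨fun h => ?_, ?_⟩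
    · have h₃ := dist_le_dist_add_one_of_adj G (p 0) h
      have h₄ := dist_le_dist_add_one_of_adj G (p 0) h.symm
      have : i ≠ j := by rintro rfl; exact G.irrefl h
      omega
    · rintro (rfl | rfl)
      · exact hp (s + i) (by omega)
      · exact (hp (s + j) (by omega)).symm
end

section
/- Let (X, ⪯) be a linearly ordered set and define a binary relation ≤ on X × ℤ by: (x,n) ≤ (x',n') iff (x ⪯ x' and n ≤ n') or (x' ≺ x and n + 2 ≤ n'). Then: (1) ≤ is a partial order on X × ℤ; (2) two elements (x,n) and (x',n') are incomparable for ≤ if and only if (x ≺ x' and n' = n − 1) or (x' ≺ x and n = n' − 1); (3) the resulting poset has width at most two, i.e., every antichain for ≤ has at most two elements. -/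
/-- The order on `X × ℤ`: `(x,n) ≤ (x',n')` iff (`x ⪯ x'` and `n ≤ n'`) or
(`x' ≺ x` and `n + 2 ≤ n'`). -/
def zprodLe {X : Type*} [LinearOrder X] (p q : X × ℤ) : Prop :=
  (p.1 ≤ q.1 ∧ p.2 ≤ q.2) ∨ (q.1 < p.1 ∧ p.2 + 2 ≤ q.2)

theorem zprodLe_incomparable_iff {X : Type*} [LinearOrder X] (p q : X × ℤ) :
    (¬ zprodLe p q ∧ ¬ zprodLe q p) ↔
      ((p.1 < q.1 ∧ q.2 = p.2 - 1) ∨ (q.1 < p.1 ∧ p.2 = q.2 - 1)) := by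
  unfold zprodLe
  rcases lt_trichotomy p.1 q.1 with h | h | h
  · simp only [h, h.le, h.not_ge, h.not_gt, true_and, false_and, or_false, false_or]
    omega
  · simp only [h, le_refl, lt_irrefl, true_and, false_and, or_false, iff_false]
    omega
  · simp only [h, h.le, h.not_ge, h.not_gt, true_and, false_and, or_false, false_or]
    omega

theorem zprodLe_trans {X : Type*} [LinearOrder X] {p q r : X × ℤ}
    (hpq : zprodLe p q) (hqr : zprodLe q r) : zprodLe p r := by
  unfold zprodLe at *
  rcases hpq with ⟨h₁, h₂⟩ | ⟨h₁, h₂⟩ <;> rcases hqr with ⟨h₃, h₄⟩ | ⟨h₃, h₄⟩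
  · exact Or.inl ⟨h₁.trans h₃, h₂.trans h₄⟩
  all_goals
    rcases le_or_gt p.1 r.1 with h | h
    · exact Or.inl ⟨h, by omega⟩
    · exact Or.inr ⟨h, by omega⟩

theorem zprodLe_antisymm {X : Type*} [LinearOrder X] {p q : X × ℤ}
    (hpq : zprodLe p q) (hqp : zprodLe q p) : p = q := by
  rcases hpq with ⟨h₁, h₂⟩ | ⟨h₁, h₂⟩ <;> rcases hqp with ⟨h₃, h₄⟩ | ⟨h₃, h₄⟩
  · exact Prod.ext (h₁.antisymm h₃) (h₂.antisymm h₄)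
  all_goals omega

/-- For a linear order `X`: (1) `zprodLe` is a partial order on `X × ℤ`; (2) two elements
are incomparable iff (`x ≺ x'` and `n' = n - 1`) or (`x' ≺ x` and `n = n' - 1`); (3) the
resulting poset has width at most two (no three pairwise incomparable elements). -/
theorem stmt_10 {X : Type*} [LinearOrder X] :
    IsPartialOrder (X × ℤ) zprodLe ∧
    (∀ p q : X × ℤ, (¬ zprodLe p q ∧ ¬ zprodLe q p) ↔
      ((p.1 < q.1 ∧ q.2 = p.2 - 1) ∨ (q.1 < p.1 ∧ p.2 = q.2 - 1))) ∧
    (∀ a b c : X × ℤ,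
      (¬ zprodLe a b ∧ ¬ zprodLe b a) → (¬ zprodLe a c ∧ ¬ zprodLe c a) →
      (¬ zprodLe b c ∧ ¬ zprodLe c b) → False) := by
  refine ⟨{ refl := fun p => Or.inl ⟨le_rfl, le_rfl⟩
            trans := fun _ _ _ => zprodLe_trans
            antisymm := fun _ _ => zprodLe_antisymm }, zprodLe_incomparable_iff, ?_⟩
  -- Incomparable elements have integer coordinates of opposite parity.
  intro a b c hab hac hbc
  rw [zprodLe_incomparable_iff] at hab hac hbc
  omega
end

section
/- The poset D, defined on [0,2π) × ℤ by (r,n) ≤ (r',n') iff (r ≤ r' and n ≤ n') or (r' < r and n + 2 ≤ n'), is order-isomorphic to the poset ℝ_{π,2}, defined on ℝ × {0,1} by (x,i) ≤ (y,j) iff (i = j and x ≤ y) or (i ≠ j and x + π ≤ y); an isomorphism is given by f(r,n) = (nπ + r, n mod 2). -/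
open Real

/-- The ground set of the poset `D`: `[0, 2π) × ℤ`. -/
abbrev DFullV : Type := (Set.Ico (0:ℝ) (2*π)) × ℤ

/-- The order of the poset `D` on `[0, 2π) × ℤ`:
`(r,n) ≤ (r',n')` iff (`r ≤ r'` and `n ≤ n'`) or (`r' < r` and `n + 2 ≤ n'`). -/
def DFullLe (p q : DFullV) : Prop :=
  ((p.1 : ℝ) ≤ (q.1 : ℝ) ∧ p.2 ≤ q.2) ∨ ((q.1 : ℝ) < (p.1 : ℝ) ∧ p.2 + 2 ≤ q.2)

/-- The order of the poset `ℝ_{π,2}` on `ℝ × {0,1}`: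
`(x,i) ≤ (y,j)` iff (`i = j` and `x ≤ y`) or (`i ≠ j` and `x + π ≤ y`). -/
def RPi2Le (p q : ℝ × Fin 2) : Prop :=
  (p.2 = q.2 ∧ p.1 ≤ q.1) ∨ (p.2 ≠ q.2 ∧ p.1 + π ≤ q.1)

/-- The map `f(r,n) = (nπ + r, n mod 2)`. -/
noncomputable def isoF (p : DFullV) : ℝ × Fin 2 :=
  ((p.2 : ℝ) * π + (p.1 : ℝ), ⟨(p.2 % 2).toNat, by omega⟩)

/-- For `|d| < 2π`, the sign of `2jπ + d` is decided lexicographically by `j` and `d`. -/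
lemma two_mul_int_mul_pi_add_nonneg_iff {d : ℝ} (h₁ : -(2 * π) < d) (h₂ : d < 2 * π) (j : ℤ) :
    0 ≤ 2 * (j : ℝ) * π + d ↔ (0 ≤ d ∧ 0 ≤ j) ∨ (d < 0 ∧ 1 ≤ j) := by
  have hπ := Real.pi_pos
  constructor
  · intro h
    rcases le_or_gt 0 d with hd | hd
    · refine Or.inl ⟨hd, ?_⟩
      by_contra! hj
      have : (j : ℝ) ≤ -1 := by exact_mod_cast (by omega : j ≤ -1)
      nlinarith
    · refine Or.inr ⟨hd, ?_⟩
      by_contra! hj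
      have : (j : ℝ) ≤ 0 := by exact_mod_cast (by omega : j ≤ 0)
      nlinarith
  · rintro (⟨hd, hj⟩ | ⟨hd, hj⟩)
    · have : (0 : ℝ) ≤ j := by exact_mod_cast hj
      positivity
    · have : (1 : ℝ) ≤ j := by exact_mod_cast hj
      nlinarith

lemma isoF_snd_eq_iff (p q : DFullV) : (isoF p).2 = (isoF q).2 ↔ p.2 % 2 = q.2 % 2 := by
  simp only [isoF, Fin.mk.injEq]
  omega

lemma dFullLe_iff_rPi2Le_isoF (p q : DFullV) : DFullLe p q ↔ RPi2Le (isoF p) (isoF q) := by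
  obtain ⟨⟨r, hr₀, hr₁⟩, n⟩ := p
  obtain ⟨⟨s, hs₀, hs₁⟩, m⟩ := q
  have key := two_mul_int_mul_pi_add_nonneg_iff (d := s - r) (by linarith) (by linarith)
  simp only [RPi2Le, DFullLe, ne_eq, isoF_snd_eq_iff]
  simp only [isoF]
  rw [← sub_nonneg (b := r), ← sub_neg (b := r)]
  by_cases hpar : n % 2 = m % 2
  · obtain ⟨j, rfl⟩ : ∃ j, m = n + 2 * j := ⟨(m - n) / 2, by omega⟩
    have h : (n : ℝ) * π + r ≤ ((n + 2 * j : ℤ) : ℝ) * π + s ↔ 0 ≤ 2 * (j : ℝ) * π + (s - r) := by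
      push_cast
      constructor <;> intro h <;> linarith
    have h₀ : n ≤ n + 2 * j ↔ 0 ≤ j := by omega
    have h₁ : n + 2 ≤ n + 2 * j ↔ 1 ≤ j := by omega
    rw [h, key, h₀, h₁]
    tauto
  · obtain ⟨j, rfl⟩ : ∃ j, m = n + 1 + 2 * j := ⟨(m - n - 1) / 2, by omega⟩
    have h : (n : ℝ) * π + r + π ≤ ((n + 1 + 2 * j : ℤ) : ℝ) * π + s ↔
        0 ≤ 2 * (j : ℝ) * π + (s - r) := by
      push_cast
      constructor <;> intro h <;> linarith
    have h₀ : n ≤ n + 1 + 2 * j ↔ 0 ≤ j := by omega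
    have h₁ : n + 2 ≤ n + 1 + 2 * j ↔ 1 ≤ j := by omega
    rw [h, key, h₀, h₁]
    tauto

lemma DFullLe.antisymm {p q : DFullV} (hpq : DFullLe p q) (hqp : DFullLe q p) : p = q := by
  rcases hpq with ⟨h₁, h₂⟩ | ⟨h₁, h₂⟩ <;> rcases hqp with ⟨h₃, h₄⟩ | ⟨h₃, h₄⟩
  · exact Prod.ext (Subtype.ext (le_antisymm h₁ h₃)) (le_antisymm h₂ h₄)
  all_goals omega

lemma isoF_injective : Function.Injective isoF := by
  intro p q h
  have hrefl (a : ℝ × Fin 2) : RPi2Le a a := Or.inl ⟨rfl, le_rfl⟩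
  refine DFullLe.antisymm ?_ ?_ <;> rw [dFullLe_iff_rPi2Le_isoF, h] <;> exact hrefl _

lemma isoF_surjective : Function.Surjective isoF := by
  rintro ⟨x, i⟩
  have hπ : 0 < 2 * π := Real.two_pi_pos
  set k : ℤ := ⌊(x - (i : ℕ) * π) / (2 * π)⌋ with hk
  have h₁ : (k : ℝ) * (2 * π) ≤ x - (i : ℕ) * π := (le_div_iff₀ hπ).1 (Int.floor_le _)
  have h₂ : x - (i : ℕ) * π < ((k : ℝ) + 1) * (2 * π) :=
    (div_lt_iff₀ hπ).1 (Int.lt_floor_add_one _)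
  refine ⟨(⟨x - (2 * k + (i : ℕ)) * π, by linarith, by linarith⟩, 2 * k + (i : ℕ)), ?_⟩
  refine Prod.ext ?_ (Fin.ext ?_)
  · simp [isoF]
  · have := i.isLt
    simp only [isoF]
    omega

/-- The poset `D` is order-isomorphic to `ℝ_{π,2}`, an isomorphism being given by
`f(r,n) = (nπ + r, n mod 2)`. -/
theorem stmt_11 :
    Function.Bijective isoF ∧
    ∀ p q : DFullV, DFullLe p q ↔ RPi2Le (isoF p) (isoF q) := by
  exact ⟨⟨isoF_injective, isoF_surjective⟩, dFullLe_iff_rPi2Le_isoF⟩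
end

section
/- Let G be a bipartite simple graph with at least three vertices. Then G is prime (i.e., has no nontrivial module) if and only if G is connected and any two distinct vertices of G have distinct neighbourhoods. -/
/-- `A` is a module of the graph `G`: every vertex outside `A` is adjacent either to all
elements of `A` or to none of them. -/
def IsGraphModule {V : Type*} (G : SimpleGraph V) (A : Set V) : Prop :=
  ∀ v ∉ A, (∀ a ∈ A, G.Adj v a) ∨ (∀ a ∈ A, ¬ G.Adj v a)

section

variable {V : Type*} {G : SimpleGraph V}

/-- Two vertices with the same neighbourhood form a module. -/
theorem isGraphModule_pair_of_neighborSet_eq {x y : V}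
    (h : G.neighborSet x = G.neighborSet y) : IsGraphModule G {x, y} := by
  intro v _
  have hxy : G.Adj v x ↔ G.Adj v y := by
    rw [G.adj_comm v x, G.adj_comm v y]
    exact Set.ext_iff.mp h v
  by_cases hv : G.Adj v x
  · left
    rintro a (rfl | rfl)
    exacts [hv, hxy.mp hv]
  · right
    rintro a (rfl | rfl)
    exacts [hv, fun hy => hv (hxy.mpr hy)]

/-- The vertex set of a connected component is a module. -/
theorem isGraphModule_setOf_reachable (x : V) : IsGraphModule G {z | G.Reachable x z} :=
  fun _ hv => Or.inr fun _ ha hva => hv (ha.trans hva.symm.reachable)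

/-- In a connected bipartite graph, all vertices of a proper module have the same
neighbourhood. -/
theorem IsGraphModule.neighborSet_eq {A : Set V} (hA : IsGraphModule G A)
    (hbip : Bipartite G) (hG : G.Connected) (hne : A ≠ Set.univ) {a b : V}
    (ha : a ∈ A) (hb : b ∈ A) : G.neighborSet a = G.neighborSet b := by
  obtain ⟨S, hS⟩ := hbip
  obtain ⟨w, hw⟩ := (Set.ne_univ_iff_exists_notMem A).mp hne
  obtain ⟨p⟩ := hG.preconnected a w
  obtain ⟨d, -, hd₁, hd₂⟩ := p.exists_boundary_dart A ha hw
  have hadj : ∀ c ∈ A, G.Adj d.snd c :=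
    (hA _ hd₂).resolve_right fun h => h _ hd₁ d.adj.symm
  have hindep : ∀ c ∈ A, ∀ u, G.Adj c u → u ∉ A := by
    intro c hc u hcu hu
    have h₁ := hS _ _ (hadj c hc)
    have h₂ := hS _ _ (hadj u hu)
    have h₃ := hS _ _ hcu
    tauto
  have key : ∀ c ∈ A, ∀ e ∈ A, ∀ u, G.Adj c u → G.Adj e u := fun c hc e he u hcu =>
    (((hA u (hindep c hc u hcu)).resolve_right fun h => h c hc hcu.symm) e he).symm
  ext u
  exact ⟨key a ha b hb u, key b hb a ha u⟩

end

/-- A bipartite graph with at least three vertices is prime (all its modules are trivial)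
iff it is connected and distinct vertices have distinct neighbourhoods. -/
theorem stmt_17 {V : Type*} (G : SimpleGraph V) (hbip : Bipartite G)
    (h3 : ∃ a b c : V, a ≠ b ∧ a ≠ c ∧ b ≠ c) :
    (∀ A : Set V, IsGraphModule G A → A.Subsingleton ∨ A = Set.univ) ↔
      (G.Connected ∧ ∀ x y : V, G.neighborSet x = G.neighborSet y → x = y) := by
  obtain ⟨a, b, c, hab, hac, hbc⟩ := h3
  constructor
  · intro hprime
    have htwin : ∀ x y : V, G.neighborSet x = G.neighborSet y → x = y := by
      intro x y hxy
      rcases hprime _ (isGraphModule_pair_of_neighborSet_eq hxy) with h | h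
      · exact h (by simp) (by simp)
      · have hmem : ∀ z, z = x ∨ z = y := Set.eq_univ_iff_forall.mp h
        have := hmem a
        have := hmem b
        have := hmem c
        grind
    refine ⟨?_, htwin⟩
    by_contra hG
    have hsub : ∀ x : V, {z | G.Reachable x z}.Subsingleton := fun x =>
      (hprime _ (isGraphModule_setOf_reachable x)).resolve_right fun h =>
        hG ((SimpleGraph.connected_iff_exists_forall_reachable G).mpr
          ⟨x, Set.eq_univ_iff_forall.mp h⟩)
    have hempty : ∀ x u : V, ¬ G.Adj x u := fun x u hxu =>
      hxu.ne (hsub x (SimpleGraph.Reachable.refl x) hxu.reachable)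
    exact hab (htwin a b (Set.ext fun u => iff_of_false (hempty a u) (hempty b u)))
  · rintro ⟨hG, htwin⟩ A hA
    by_cases hne : A = Set.univ
    · exact Or.inr hne
    · exact Or.inl fun x hx y hy => htwin x y (hA.neighborSet_eq hbip hG hne hx hy)
end
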